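/- arXiv:math/0402207 — 11 statements merged into one kernel-verified Lean document; each statement's English description precedes it below -/
import Mathlib

section
/- Let T be an N-Jacobi flow. Then for every t ∈ [0,b] the bilinear form Φ(t)(u,v) := B(T(t)u, T'(t)v) is symmetric: B(T(t)u, T'(t)v) = B(T(t)v, T'(t)u) for all u, v ∈ H. -/
open Set

/-- `T` is an `N`-Jacobi flow on `[0,b]`: a twice continuously differentiable
operator-valued map with `T'' + R ∘ T = 0`, `T 0 = P_V` and `T' 0 = -A + P_W`. -/
def IsNJacobiFlow {H : Type*} [NormedAddCommGroup H] [InnerProductSpace ℝ H]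
    (b : ℝ) (R : ℝ → H →L[ℝ] H) (PV PW A : H →L[ℝ] H)
    (T T' T'' : ℝ → H →L[ℝ] H) : Prop :=
  (∀ t ∈ Icc (0:ℝ) b, HasDerivWithinAt T (T' t) (Icc 0 b) t) ∧
  (∀ t ∈ Icc (0:ℝ) b, HasDerivWithinAt T' (T'' t) (Icc 0 b) t) ∧
  ContinuousOn T'' (Icc 0 b) ∧
  (∀ t ∈ Icc (0:ℝ) b, T'' t + (R t).comp (T t) = 0) ∧
  T 0 = PV ∧ T' 0 = -A + PW

/-- The bilinear form `Φ(t)(u,v) = B(T(t)u, T'(t)v)` is symmetric for every `t ∈ [0,b]`. -/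
theorem nJacobiFlow_phi_symmetric
    {H : Type*} [NormedAddCommGroup H] [InnerProductSpace ℝ H] [CompleteSpace H]
    (B : H →L[ℝ] H →L[ℝ] ℝ)
    (hBsymm : ∀ x y : H, B x y = B y x)
    (hBpos : ∀ x : H, x ≠ 0 → 0 < B x x)
    (b : ℝ) (hb : 0 < b)
    (R : ℝ → H →L[ℝ] H)
    (hRcont : ContinuousOn R (Icc 0 b))
    (hRsymm : ∀ t ∈ Icc (0:ℝ) b, ∀ x y : H, B (R t x) y = B x (R t y))
    (V W : Submodule ℝ H)
    (hVclosed : IsClosed (V : Set H)) (hWclosed : IsClosed (W : Set H))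
    (hcompl : IsCompl V W)
    (hBorth : ∀ v ∈ V, ∀ w ∈ W, B v w = 0)
    (PV PW : H →L[ℝ] H)
    (hPV : ∀ x : H, PV x ∈ V) (hPW : ∀ x : H, PW x ∈ W)
    (hPVW : ∀ x : H, PV x + PW x = x)
    (A : H →L[ℝ] H)
    (hArange : ∀ x : H, A x ∈ V) (hAW : ∀ w ∈ W, A w = 0)
    (hAsymm : ∀ x y : H, B (A x) y = B x (A y))
    (T T' T'' : ℝ → H →L[ℝ] H)
    (hT : IsNJacobiFlow b R PV PW A T T' T'') :
    ∀ t ∈ Icc (0:ℝ) b, ∀ u v : H, B (T t u) (T' t v) = B (T t v) (T' t u) := by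
  obtain ⟨h1, h2, -, h3, h4, h5⟩ := hT
  intro t ht u v
  have key : ∀ u v : H, ∀ s ∈ Icc (0:ℝ) b,
      HasDerivWithinAt (fun s => B (T s u) (T' s v))
        (B (T' s u) (T' s v) + B (T s u) (T'' s v)) (Icc 0 b) s := by
    intro u v s hs
    have e1 : HasDerivWithinAt (fun s => T s u) (T' s u) (Icc 0 b) s := by
      simpa using (h1 s hs).clm_apply (hasDerivWithinAt_const s (Icc 0 b) u)
    have e2 : HasDerivWithinAt (fun s => T' s v) (T'' s v) (Icc 0 b) s := by
      simpa using (h2 s hs).clm_apply (hasDerivWithinAt_const s (Icc 0 b) v)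
    have e3 : HasDerivWithinAt (fun s => B (T s u)) (B (T' s u)) (Icc 0 b) s :=
      B.hasFDerivAt.comp_hasDerivWithinAt s e1
    exact e3.clm_apply e2
  have hT2 : ∀ s ∈ Icc (0:ℝ) b, ∀ x, T'' s x = -(R s (T s x)) := by
    intro s hs x
    have := congrArg (fun L : H →L[ℝ] H => L x) (h3 s hs)
    exact eq_neg_of_add_eq_zero_left (by simpa using this)
  have hd : ∀ s ∈ Icc (0:ℝ) b,
      HasDerivWithinAt (fun s => B (T s u) (T' s v) - B (T s v) (T' s u)) 0 (Icc 0 b) s := by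
    intro s hs
    refine ((key u v s hs).sub (key v u s hs)).congr_deriv ?_
    rw [hT2 s hs, hT2 s hs, map_neg, map_neg, ← hRsymm s hs, hBsymm (T' s u),
      hBsymm (R s (T s u))]
    ring
  have hc := constant_of_derivWithin_zero (fun s hs => (hd s hs).differentiableWithinAt)
    (fun s hs => (hd s (Ico_subset_Icc_self hs)).derivWithin
      (uniqueDiffOn_Icc hb s (Ico_subset_Icc_self hs))) t ht
  have hA : ∀ x, A (PV x) = A x := by
    intro x
    conv_rhs => rw [← hPVW x, map_add, hAW _ (hPW x), add_zero]
  have h0 : ∀ x y, B (PV x) ((-A + PW) y) = - B (A x) y := by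
    intro x y
    have : (-A + PW) y = -(A y) + PW y := rfl
    rw [this, map_add, map_neg, hBorth _ (hPV x) _ (hPW y), ← hAsymm, hA, add_zero]
  simp only [h4, h5, h0] at hc
  rw [hAsymm u v, hBsymm u (A v)] at hc
  linarith
end

section
/- (Ambrose's formula) Let T be an N-Jacobi flow and let J : [0,b] → H be a Jacobi solution (J''(t) + R(t)(J(t)) = 0) with J(b) = 0. Then for every z ∈ H: B(T(b)z, J'(b)) = B(T(0)z, J'(0)) − B(T'(0)z, J(0)). -/
open Set

/-- `J` is a Jacobi solution on `[0,b]` for `R`, with derivatives `J'`, `J''`. -/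
def IsJacobiSolutionOn {E : Type*} [NormedAddCommGroup E] [NormedSpace ℝ E]
    (b : ℝ) (R : ℝ → E →L[ℝ] E) (J J' J'' : ℝ → E) : Prop :=
  (∀ t ∈ Icc (0:ℝ) b, HasDerivWithinAt J (J' t) (Icc 0 b) t) ∧
  (∀ t ∈ Icc (0:ℝ) b, HasDerivWithinAt J' (J'' t) (Icc 0 b) t) ∧
  ContinuousOn J'' (Icc 0 b) ∧
  ∀ t ∈ Icc (0:ℝ) b, J'' t + R t (J t) = 0

/-- (Ambrose's formula) If `T` is an `N`-Jacobi flow and `J` is a Jacobi solution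
with `J b = 0`, then `B(T(b)z, J'(b)) = B(T(0)z, J'(0)) − B(T'(0)z, J(0))` for all `z`. -/
theorem ambrose_formula
    {H : Type*} [NormedAddCommGroup H] [InnerProductSpace ℝ H] [CompleteSpace H]
    (B : H →L[ℝ] H →L[ℝ] ℝ)
    (hBsymm : ∀ x y : H, B x y = B y x)
    (hBpos : ∀ x : H, x ≠ 0 → 0 < B x x)
    (b : ℝ) (hb : 0 < b)
    (R : ℝ → H →L[ℝ] H)
    (hRcont : ContinuousOn R (Icc 0 b))
    (hRsymm : ∀ t ∈ Icc (0:ℝ) b, ∀ x y : H, B (R t x) y = B x (R t y))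
    (V W : Submodule ℝ H)
    (hVclosed : IsClosed (V : Set H)) (hWclosed : IsClosed (W : Set H))
    (hcompl : IsCompl V W)
    (hBorth : ∀ v ∈ V, ∀ w ∈ W, B v w = 0)
    (PV PW : H →L[ℝ] H)
    (hPV : ∀ x : H, PV x ∈ V) (hPW : ∀ x : H, PW x ∈ W)
    (hPVW : ∀ x : H, PV x + PW x = x)
    (A : H →L[ℝ] H)
    (hArange : ∀ x : H, A x ∈ V) (hAW : ∀ w ∈ W, A w = 0)
    (hAsymm : ∀ x y : H, B (A x) y = B x (A y))
    (T T' T'' : ℝ → H →L[ℝ] H)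
    (hT : IsNJacobiFlow b R PV PW A T T' T'')
    (J J' J'' : ℝ → H)
    (hJ : IsJacobiSolutionOn b R J J' J'')
    (hJb : J b = 0) :
    ∀ z : H, B (T b z) (J' b) = B (T 0 z) (J' 0) - B (T' 0 z) (J 0) := by
  intro z
  obtain ⟨hT1, hT2, -, hT3, -, -⟩ := hT
  obtain ⟨hJ1, hJ2, -, hJ3⟩ := hJ
  have key : ∀ t ∈ Icc (0:ℝ) b,
      HasDerivWithinAt (fun t => B (T t z) (J' t) - B (T' t z) (J t)) 0 (Icc 0 b) t := by
    intro t ht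
    have a1 : HasDerivWithinAt (fun t => T t z) (T' t z) (Icc 0 b) t := by
      simpa using (hT1 t ht).clm_apply (hasDerivWithinAt_const t (Icc 0 b) z)
    have a2 : HasDerivWithinAt (fun t => T' t z) (T'' t z) (Icc 0 b) t := by
      simpa using (hT2 t ht).clm_apply (hasDerivWithinAt_const t (Icc 0 b) z)
    have b1 := (B.hasFDerivAt.comp_hasDerivWithinAt t a1).clm_apply (hJ2 t ht)
    have b2 := (B.hasFDerivAt.comp_hasDerivWithinAt t a2).clm_apply (hJ1 t ht)
    have c := b1.sub b2
    have e1 : T'' t z = -(R t (T t z)) := by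
      have h := congrArg (fun L : H →L[ℝ] H => L z) (hT3 t ht)
      simp only [add_apply, ContinuousLinearMap.comp_apply, zero_apply] at h
      exact eq_neg_of_add_eq_zero_left h
    have e2 : J'' t = -(R t (J t)) := eq_neg_of_add_eq_zero_left (hJ3 t ht)
    refine c.congr_deriv ?_
    simp only [Function.comp_apply, e1, e2, map_neg, neg_apply, hRsymm t ht]
    ring
  have hc := constant_of_has_deriv_right_zero
    (fun t ht => (key t ht).continuousWithinAt)
    (fun t ht => ((key t (Ico_subset_Icc_self ht)).mono_of_mem_nhdsWithin
      (Icc_mem_nhdsGE_of_mem ht))) b (right_mem_Icc.2 hb.le)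
  simpa [hJb] using hc
end

section
/- Let T be an N-Jacobi flow, T̃ the reversed flow at b, and T*(b) := P_V ∘ T̃'(b) − A ∘ T̃(b) + P_W ∘ T̃(b). Then for all z, u ∈ H one has B(T(b)z, u) = B(z, T*(b)u); that is, T*(b) is an adjoint of T(b) with respect to B, given explicitly in terms of the reversed Jacobi flow. -/
open Set

/-- `S` is the reversed Jacobi flow at `b`: `S'' t + R(b−t) ∘ S t = 0`,
`S 0 = 0`, `S' 0 = id`. -/
def IsReversedFlow {H : Type*} [NormedAddCommGroup H] [InnerProductSpace ℝ H]
    (b : ℝ) (R : ℝ → H →L[ℝ] H) (S S' S'' : ℝ → H →L[ℝ] H) : Prop :=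
  (∀ t ∈ Icc (0:ℝ) b, HasDerivWithinAt S (S' t) (Icc 0 b) t) ∧
  (∀ t ∈ Icc (0:ℝ) b, HasDerivWithinAt S' (S'' t) (Icc 0 b) t) ∧
  ContinuousOn S'' (Icc 0 b) ∧
  (∀ t ∈ Icc (0:ℝ) b, S'' t + (R (b - t)).comp (S t) = 0) ∧
  S 0 = 0 ∧ S' 0 = ContinuousLinearMap.id ℝ H

/-- The operator `T*(b) = P_V ∘ T̃'(b) − A ∘ T̃(b) + P_W ∘ T̃(b)` is an adjoint of
`T(b)` with respect to `B`. -/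
theorem nJacobiFlow_adjoint
    {H : Type*} [NormedAddCommGroup H] [InnerProductSpace ℝ H] [CompleteSpace H]
    (B : H →L[ℝ] H →L[ℝ] ℝ)
    (hBsymm : ∀ x y : H, B x y = B y x)
    (hBpos : ∀ x : H, x ≠ 0 → 0 < B x x)
    (b : ℝ) (hb : 0 < b)
    (R : ℝ → H →L[ℝ] H)
    (hRcont : ContinuousOn R (Icc 0 b))
    (hRsymm : ∀ t ∈ Icc (0:ℝ) b, ∀ x y : H, B (R t x) y = B x (R t y))
    (V W : Submodule ℝ H)
    (hVclosed : IsClosed (V : Set H)) (hWclosed : IsClosed (W : Set H))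
    (hcompl : IsCompl V W)
    (hBorth : ∀ v ∈ V, ∀ w ∈ W, B v w = 0)
    (PV PW : H →L[ℝ] H)
    (hPV : ∀ x : H, PV x ∈ V) (hPW : ∀ x : H, PW x ∈ W)
    (hPVW : ∀ x : H, PV x + PW x = x)
    (A : H →L[ℝ] H)
    (hArange : ∀ x : H, A x ∈ V) (hAW : ∀ w ∈ W, A w = 0)
    (hAsymm : ∀ x y : H, B (A x) y = B x (A y))
    (T T' T'' : ℝ → H →L[ℝ] H)
    (hT : IsNJacobiFlow b R PV PW A T T' T'')
    (S S' S'' : ℝ → H →L[ℝ] H)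
    (hS : IsReversedFlow b R S S' S'') :
    ∀ z u : H,
      B (T b z) u = B z ((PV.comp (S' b) - A.comp (S b) + PW.comp (S b)) u) := by
  intro z u
  obtain ⟨hT1, hT2, -, hTeq, hT0, hT'0⟩ := hT
  obtain ⟨hS1, hS2, -, hSeq, hS0, hS'0⟩ := hS
  have hmaps : MapsTo (fun t : ℝ => b - t) (Icc 0 b) (Icc 0 b) := by
    intro t ht
    exact ⟨by linarith [ht.2], by linarith [ht.1]⟩
  have happ : ∀ (F : ℝ → H →L[ℝ] H) (F' : H →L[ℝ] H) (t : ℝ) (x : H),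
      HasDerivWithinAt F F' (Icc 0 b) t →
      HasDerivWithinAt (fun s => F s x) (F' x) (Icc 0 b) t := by
    intro F F' t x h
    simpa using h.clm_apply (hasDerivWithinAt_const t (Icc 0 b) x)
  have hrev : ∀ (F : ℝ → H →L[ℝ] H) (F' : H →L[ℝ] H) (t : ℝ) (x : H), t ∈ Icc (0:ℝ) b →
      HasDerivWithinAt F F' (Icc 0 b) (b - t) →
      HasDerivWithinAt (fun s => F (b - s) x) (-(F' x)) (Icc 0 b) t := by
    intro F F' t x ht h
    have h1 : HasDerivWithinAt (fun s : ℝ => b - s) (-1) (Icc 0 b) t := by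
      simpa using (hasDerivWithinAt_id t (Icc 0 b)).const_sub b
    have h2 := HasDerivWithinAt.scomp t (happ F F' (b - t) x h) h1 hmaps
    simpa [Function.comp_def] using h2
  have hd : ∀ t ∈ Icc (0:ℝ) b, HasDerivWithinAt
      (fun t => B (T' t z) (S (b - t) u) + B (T t z) (S' (b - t) u)) 0 (Icc 0 b) t := by
    intro t ht
    have hbt := hmaps ht
    have h1 := B.hasDerivWithinAt_of_bilinear (happ _ _ t z (hT2 t ht))
      (hrev _ _ t u ht (hS1 _ hbt))
    have h2 := B.hasDerivWithinAt_of_bilinear (happ _ _ t z (hT1 t ht))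
      (hrev _ _ t u ht (hS2 _ hbt))
    refine (h1.add h2).congr_deriv ?_
    have e1 : T'' t z = -(R t (T t z)) := by
      have := congrArg (fun L : H →L[ℝ] H => L z) (hTeq t ht)
      exact eq_neg_of_add_eq_zero_left (by simpa using this)
    have e2 : S'' (b - t) u = -(R t (S (b - t) u)) := by
      have := congrArg (fun L : H →L[ℝ] H => L u) (hSeq _ hbt)
      exact eq_neg_of_add_eq_zero_left (by simpa using this)
    simp only [e1, e2, map_neg, neg_neg, ContinuousLinearMap.neg_apply, hRsymm t ht]
    ring
  have hc := constant_of_has_deriv_right_zero (fun t ht => (hd t ht).continuousWithinAt)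
    (fun t ht => (hd t ⟨ht.1, ht.2.le⟩).mono_of_mem_nhdsWithin
      (Icc_mem_nhdsGE_of_mem ht)) b ⟨hb.le, le_rfl⟩
  simp only [sub_self, sub_zero, hS0, hS'0, hT0, hT'0, ContinuousLinearMap.zero_apply,
    map_zero, zero_add, ContinuousLinearMap.id_apply, ContinuousLinearMap.add_apply,
    ContinuousLinearMap.neg_apply, map_add, map_neg, hAsymm] at hc
  have hV : ∀ x y : H, B (PV x) y = B x (PV y) := by
    intro x y
    have h1 : B (PV x) y = B (PV x) (PV y) := by
      conv_lhs => rw [← hPVW y]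
      rw [map_add, hBorth _ (hPV x) _ (hPW y), add_zero]
    have h2 : B x (PV y) = B (PV x) (PV y) := by
      conv_lhs => rw [← hPVW x]
      rw [map_add, ContinuousLinearMap.add_apply, hBsymm (PW x), hBorth _ (hPV y) _ (hPW x),
        add_zero]
    rw [h1, h2]
  have hW : ∀ x y : H, B (PW x) y = B x (PW y) := by
    intro x y
    have hx : PW x = x - PV x := eq_sub_of_add_eq' (hPVW x)
    have hy : PW y = y - PV y := eq_sub_of_add_eq' (hPVW y)
    rw [hx, hy, map_sub, map_sub, ContinuousLinearMap.sub_apply, hV]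
  rw [hc, hV, hW]
  simp only [ContinuousLinearMap.add_apply, ContinuousLinearMap.sub_apply,
    ContinuousLinearMap.comp_apply, map_add, map_sub]
  ring
end

section
/- Let T be an N-Jacobi flow, T̃ the reversed flow at b, and T*(b) := P_V ∘ T̃'(b) − A ∘ T̃(b) + P_W ∘ T̃(b). Then the linear map w ↦ −T'(b)w restricts to a linear bijection from ker T(b) onto ker T*(b); in particular the kernel of T(b) and the kernel of its B-adjoint T*(b) are isomorphic real vector spaces. -/
open Set

theorem jac_zero_left {H : Type*} [NormedAddCommGroup H] [NormedSpace ℝ H]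
    (b : ℝ) (Q : ℝ → H →L[ℝ] H) (hQ : ContinuousOn Q (Icc 0 b))
    (f f' : ℝ → H)
    (hf : ∀ t ∈ Icc (0:ℝ) b, HasDerivWithinAt f (f' t) (Icc 0 b) t)
    (hf' : ∀ t ∈ Icc (0:ℝ) b, HasDerivWithinAt f' (-(Q t (f t))) (Icc 0 b) t)
    (h0 : f 0 = 0) (h0' : f' 0 = 0) :
    ∀ t ∈ Icc (0:ℝ) b, f t = 0 ∧ f' t = 0 := by
  obtain ⟨C, hC⟩ := isCompact_Icc.exists_bound_of_continuousOn hQ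
  have hd : ∀ t ∈ Icc (0:ℝ) b,
      HasDerivWithinAt (fun t => (f t, f' t)) (f' t, -(Q t (f t))) (Icc 0 b) t :=
    fun t ht => (hf t ht).prodMk (hf' t ht)
  have key : ∀ t ∈ Icc (0:ℝ) b, (f t, f' t) = (0 : H × H) := by
    refine eq_zero_of_abs_deriv_le_mul_abs_self_of_eq_zero_right (K := max 1 C)
      (f := fun t => (f t, f' t)) (f' := fun t => (f' t, -(Q t (f t))))
      (fun t ht => (hd t ht).continuousWithinAt) ?_ ?_ ?_
    · intro t ht
      exact (hd t ⟨ht.1, ht.2.le⟩).mono_of_mem_nhdsWithin (Icc_mem_nhdsGE_of_mem ht)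
    · simp [h0, h0']
    · intro t ht
      have hC1 := hC t ⟨ht.1, ht.2.le⟩
      have e1 : ‖f t‖ ≤ ‖(f t, f' t)‖ := norm_fst_le (f t, f' t)
      have e2 : ‖f' t‖ ≤ ‖(f t, f' t)‖ := norm_snd_le (f t, f' t)
      have hn : 0 ≤ ‖(f t, f' t)‖ := norm_nonneg _
      refine norm_prod_le_iff.2 ⟨?_, ?_⟩
      · calc ‖f' t‖ ≤ 1 * ‖(f t, f' t)‖ := by simpa using e2
          _ ≤ _ := mul_le_mul_of_nonneg_right (le_max_left _ _) hn
      · calc ‖-(Q t (f t))‖ = ‖Q t (f t)‖ := norm_neg _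
          _ ≤ ‖Q t‖ * ‖f t‖ := (Q t).le_opNorm _
          _ ≤ max 1 C * ‖(f t, f' t)‖ :=
            mul_le_mul (hC1.trans (le_max_right _ _)) e1 (norm_nonneg _) (by positivity)
  intro t ht
  simpa using key t ht

theorem jac_rev {H : Type*} [NormedAddCommGroup H] [NormedSpace ℝ H]
    (b : ℝ) (f f' : ℝ → H)
    (hf : ∀ t ∈ Icc (0:ℝ) b, HasDerivWithinAt f (f' t) (Icc 0 b) t) :
    ∀ t ∈ Icc (0:ℝ) b, HasDerivWithinAt (fun t => f (b - t)) (-(f' (b - t))) (Icc 0 b) t := by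
  intro t ht
  have hm : MapsTo (fun t : ℝ => b - t) (Icc 0 b) (Icc 0 b) := fun s hs =>
    ⟨by linarith [hs.2], by linarith [hs.1]⟩
  have h := (hf (b - t) (hm ht)).scomp t ((hasDerivWithinAt_id t (Icc 0 b)).const_sub b) hm
  simpa [Function.comp_def] using h

theorem jac_zero_right {H : Type*} [NormedAddCommGroup H] [NormedSpace ℝ H]
    (b : ℝ) (Q : ℝ → H →L[ℝ] H) (hQ : ContinuousOn Q (Icc 0 b))
    (f f' : ℝ → H)
    (hf : ∀ t ∈ Icc (0:ℝ) b, HasDerivWithinAt f (f' t) (Icc 0 b) t)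
    (hf' : ∀ t ∈ Icc (0:ℝ) b, HasDerivWithinAt f' (-(Q t (f t))) (Icc 0 b) t)
    (h0 : f b = 0) (h0' : f' b = 0) :
    ∀ t ∈ Icc (0:ℝ) b, f t = 0 ∧ f' t = 0 := by
  have hm : MapsTo (fun t : ℝ => b - t) (Icc 0 b) (Icc 0 b) := fun s hs =>
    ⟨by linarith [hs.2], by linarith [hs.1]⟩
  have h := jac_zero_left b (fun t => Q (b - t))
    (hQ.comp (by fun_prop) hm) (fun t => f (b - t)) (fun t => -(f' (b - t)))
    (jac_rev b f f' hf)
    (fun t ht => by simpa using (jac_rev b f' _ hf' t ht).fun_neg)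
    (by simpa using h0) (by simpa using h0')
  intro t ht
  simpa using h (b - t) (hm ht)

/-- The map `w ↦ −T'(b)w` restricts to a bijection from `ker T(b)` onto
`ker T*(b)`, where `T*(b) = P_V ∘ T̃'(b) − A ∘ T̃(b) + P_W ∘ T̃(b)`; in particular
the two kernels are isomorphic real vector spaces. -/
theorem ker_jacobiFlow_bijOn_ker_adjoint
    {H : Type*} [NormedAddCommGroup H] [InnerProductSpace ℝ H] [CompleteSpace H]
    (B : H →L[ℝ] H →L[ℝ] ℝ)
    (hBsymm : ∀ x y : H, B x y = B y x)
    (hBpos : ∀ x : H, x ≠ 0 → 0 < B x x)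
    (b : ℝ) (hb : 0 < b)
    (R : ℝ → H →L[ℝ] H)
    (hRcont : ContinuousOn R (Icc 0 b))
    (hRsymm : ∀ t ∈ Icc (0:ℝ) b, ∀ x y : H, B (R t x) y = B x (R t y))
    (V W : Submodule ℝ H)
    (hVclosed : IsClosed (V : Set H)) (hWclosed : IsClosed (W : Set H))
    (hcompl : IsCompl V W)
    (hBorth : ∀ v ∈ V, ∀ w ∈ W, B v w = 0)
    (PV PW : H →L[ℝ] H)
    (hPV : ∀ x : H, PV x ∈ V) (hPW : ∀ x : H, PW x ∈ W)
    (hPVW : ∀ x : H, PV x + PW x = x)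
    (A : H →L[ℝ] H)
    (hArange : ∀ x : H, A x ∈ V) (hAW : ∀ w ∈ W, A w = 0)
    (hAsymm : ∀ x y : H, B (A x) y = B x (A y))
    (T T' T'' : ℝ → H →L[ℝ] H)
    (hT : IsNJacobiFlow b R PV PW A T T' T'')
    (S S' S'' : ℝ → H →L[ℝ] H)
    (hS : IsReversedFlow b R S S' S'') :
    Set.BijOn (fun w : H => -(T' b w))
      {w : H | T b w = 0}
      {u : H | (PV.comp (S' b) - A.comp (S b) + PW.comp (S b)) u = 0} := by
  obtain ⟨hT1, hT2, -, hT3, hT0, hT0'⟩ := hT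
  obtain ⟨hS1, hS2, -, hS3, hS0, hS0'⟩ := hS
  have h0m : (0:ℝ) ∈ Icc (0:ℝ) b := ⟨le_rfl, hb.le⟩
  have hbm : b ∈ Icc (0:ℝ) b := ⟨hb.le, le_rfl⟩
  have hm : MapsTo (fun t : ℝ => b - t) (Icc 0 b) (Icc 0 b) := fun s hs =>
    ⟨by linarith [hs.2], by linarith [hs.1]⟩
  -- algebra of the projections
  have hdis : ∀ x, x ∈ V → x ∈ W → x = 0 := fun x hx hx' =>
    Submodule.disjoint_def.1 hcompl.disjoint x hx hx'
  have hPVv : ∀ x ∈ V, PV x = x ∧ PW x = 0 := by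
    intro x hx
    have h : PW x = 0 := by
      refine hdis _ ?_ (hPW x)
      have : PW x = x - PV x := by rw [eq_sub_iff_add_eq, add_comm]; exact hPVW x
      rw [this]; exact V.sub_mem hx (hPV x)
    refine ⟨?_, h⟩
    have := hPVW x
    rwa [h, add_zero] at this
  have hPWw : ∀ x ∈ W, PV x = 0 ∧ PW x = x := by
    intro x hx
    have h : PV x = 0 := by
      refine hdis _ (hPV x) ?_
      have : PV x = x - PW x := by rw [eq_sub_iff_add_eq]; exact hPVW x
      rw [this]; exact W.sub_mem hx (hPW x)
    refine ⟨h, ?_⟩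
    have := hPVW x
    rwa [h, zero_add] at this
  have hsplit : ∀ x y, x ∈ V → y ∈ W → x + y = 0 → x = 0 ∧ y = 0 := by
    intro x y hx hy hxy
    have hx0 : x = 0 := hdis x hx (by rw [eq_neg_of_add_eq_zero_left hxy]; exact W.neg_mem hy)
    exact ⟨hx0, by simpa [hx0] using hxy⟩
  -- pointwise derivatives
  have hTd : ∀ w, ∀ t ∈ Icc (0:ℝ) b,
      HasDerivWithinAt (fun t => T t w) (T' t w) (Icc 0 b) t := fun w t ht => by
    simpa using (hT1 t ht).clm_apply (hasDerivWithinAt_const t (Icc 0 b) w)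
  have hTd' : ∀ w, ∀ t ∈ Icc (0:ℝ) b,
      HasDerivWithinAt (fun t => T' t w) (-(R t (T t w))) (Icc 0 b) t := fun w t ht => by
    have e : -(R t (T t w)) = T'' t w := by
      rw [eq_neg_of_add_eq_zero_left (hT3 t ht)]; simp
    rw [e]
    simpa using (hT2 t ht).clm_apply (hasDerivWithinAt_const t (Icc 0 b) w)
  have hSd : ∀ w, ∀ t ∈ Icc (0:ℝ) b,
      HasDerivWithinAt (fun t => S t w) (S' t w) (Icc 0 b) t := fun w t ht => by
    simpa using (hS1 t ht).clm_apply (hasDerivWithinAt_const t (Icc 0 b) w)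
  have hSd' : ∀ w, ∀ t ∈ Icc (0:ℝ) b,
      HasDerivWithinAt (fun t => S' t w) (-(R (b - t) (S t w))) (Icc 0 b) t := fun w t ht => by
    have e : -(R (b - t) (S t w)) = S'' t w := by
      rw [eq_neg_of_add_eq_zero_left (hS3 t ht)]; simp
    rw [e]
    simpa using (hS2 t ht).clm_apply (hasDerivWithinAt_const t (Icc 0 b) w)
  -- the difference of `T t w` and `S (b - t) u`
  have hD : ∀ w u, ∀ t ∈ Icc (0:ℝ) b,
      HasDerivWithinAt (fun t => T t w - S (b - t) u) (T' t w + S' (b - t) u) (Icc 0 b) t := by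
    intro w u t ht
    simpa using (hTd w t ht).fun_sub (jac_rev b _ _ (hSd u) t ht)
  have hD' : ∀ w u, ∀ t ∈ Icc (0:ℝ) b,
      HasDerivWithinAt (fun t => T' t w + S' (b - t) u)
        (-(R t (T t w - S (b - t) u))) (Icc 0 b) t := by
    intro w u t ht
    have h := (hTd' w t ht).add (jac_rev b _ _ (hSd' u) t ht)
    have e : -(R t (T t w - S (b - t) u))
        = -(R t (T t w)) + -(-(R (b - (b - t)) (S (b - t) u))) := by
      rw [sub_sub_cancel, map_sub]; abel
    rw [e]
    exact h
  refine ⟨?_, ?_, ?_⟩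
  · intro w hw
    simp only [mem_setOf_eq] at hw ⊢
    obtain ⟨h1, h2⟩ := jac_zero_right b R hRcont _ _ (hD w (-(T' b w))) (hD' w (-(T' b w)))
      (by simp [hw, hS0]) (by simp [hS0']) 0 h0m
    rw [sub_zero, hT0, sub_eq_zero] at h1
    rw [sub_zero, hT0'] at h2
    have h2' := eq_neg_of_add_eq_zero_right h2
    simp only [ContinuousLinearMap.add_apply, ContinuousLinearMap.sub_apply,
      ContinuousLinearMap.comp_apply]
    rw [← h1, h2', (hPVv _ (hPV w)).2, add_zero]
    have hA : A w = A (PV w) := by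
      conv_lhs => rw [← hPVW w]
      rw [map_add, hAW _ (hPW w), add_zero]
    simp [(hPVv _ (hArange w)).1, (hPWw _ (hPW w)).1, hA, (hPVv _ (hArange (PV w))).1]
  · intro w₁ hw₁ w₂ hw₂ h
    simp only [mem_setOf_eq] at hw₁ hw₂
    have h' : T' b w₁ = T' b w₂ := neg_injective h
    obtain ⟨h1, h2⟩ := jac_zero_right b R hRcont _ _ (hTd (w₁ - w₂)) (hTd' (w₁ - w₂))
      (by simp [hw₁, hw₂]) (by simp [h']) 0 h0m
    rw [hT0] at h1
    rw [hT0'] at h2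
    have h3 := (hsplit _ _ (V.neg_mem (hArange (w₁ - w₂))) (hPW (w₁ - w₂)) h2).2
    have h4 := hPVW (w₁ - w₂)
    rw [h1, h3, add_zero] at h4
    exact sub_eq_zero.1 h4.symm
  · intro u hu
    simp only [mem_setOf_eq, ContinuousLinearMap.add_apply, ContinuousLinearMap.sub_apply,
      ContinuousLinearMap.comp_apply] at hu
    obtain ⟨h1, h2⟩ := hsplit _ _ (V.sub_mem (hPV _) (hArange _)) (hPW _) hu
    rw [sub_eq_zero] at h1
    have hSV : PV (S b u) = S b u := by
      have := hPVW (S b u)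
      rwa [h2, add_zero] at this
    have hw1 := (hPWw _ (hPW (S' b u)))
    obtain ⟨h3, h4⟩ := jac_zero_left b R hRcont _ _ (hD (S b u - PW (S' b u)) u)
      (hD' (S b u - PW (S' b u)) u)
      (by simp [hT0, hSV, hw1.1])
      (by
        have h5 := hPVW (S' b u)
        simp only [hT0', sub_zero, ContinuousLinearMap.add_apply, ContinuousLinearMap.neg_apply,
          map_sub, hAW _ (hPW (S' b u)), h2, hw1.2, ← h1]
        nth_rewrite 3 [← h5]
        abel) b hbm
    refine ⟨S b u - PW (S' b u), ?_, ?_⟩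
    · simpa [hS0] using h3
    · simp only [sub_self, hS0', ContinuousLinearMap.id_apply] at h4
      exact (eq_neg_of_add_eq_zero_right h4).symm
end

section
/- Let T be an N-Jacobi flow and let t₀ ∈ (0,b]. If T(t₀) is injective, then the range of T(t₀) has trivial B-orthogonal complement: every u ∈ H with B(T(t₀)z, u) = 0 for all z ∈ H must be u = 0. In particular, if B is the inner product of H, then the range of T(t₀) is dense in H. -/
open Set

open scoped NNReal Topology

theorem linODE_step {E : Type*} [NormedAddCommGroup E] [NormedSpace ℝ E] [CompleteSpace E]
    (M : ℝ → E →L[ℝ] E) (K : ℝ≥0) (s t : ℝ) (hst : s ≤ t)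
    (hM : ContinuousOn M (Icc s t)) (hK : ∀ r ∈ Icc s t, ‖M r‖ ≤ K)
    (hsmall : (K : ℝ) * (t - s) ≤ 1 / 2) (x : E) :
    ∃ y : ℝ → E, y t = x ∧ ∀ r ∈ Icc s t, HasDerivWithinAt y (M r (y r)) (Icc s t) r := by
  have hPL : IsPicardLindelof (fun r z => M r z) (⟨t, hst, le_rfl⟩ : Icc s t) x
      ‖x‖₊ 0 (2 * K * ‖x‖₊) K := by
    refine ⟨?_, ?_, ?_, ?_⟩
    · intro r hr
      have h1 : ‖M r‖₊ ≤ K := hK r hr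
      exact ((M r).lipschitz.weaken h1).lipschitzOnWith
    · intro z _
      exact hM.clm_apply continuousOn_const
    · intro r hr z hz
      have h1 : ‖z‖ ≤ 2 * ‖x‖ := by
        have h2 : ‖z - x‖ ≤ ‖x‖ := by
          have := mem_closedBall_iff_norm.1 hz
          simpa using this
        have h3 : ‖z‖ ≤ ‖z - x‖ + ‖x‖ := by
          simpa using norm_add_le (z - x) x
        linarith
      calc ‖M r z‖ ≤ ‖M r‖ * ‖z‖ := (M r).le_opNorm z
        _ ≤ K * (2 * ‖x‖) := mul_le_mul (hK r hr) h1 (norm_nonneg _) K.2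
        _ = ((2 * K * ‖x‖₊ : ℝ≥0) : ℝ) := by push_cast; ring
    · have h0 : max (t - t) (t - s) = t - s := by
        rw [sub_self]; exact max_eq_right (by linarith)
      push_cast
      simp only [h0, sub_zero]
      nlinarith [norm_nonneg x]
  exact hPL.exists_eq_forall_mem_Icc_hasDerivWithinAt₀

theorem linODE_glue {E : Type*} [NormedAddCommGroup E] [NormedSpace ℝ E]
    (M : ℝ → E →L[ℝ] E) (s m t : ℝ) (hsm : s ≤ m) (hmt : m ≤ t) (y z : ℝ → E)
    (hyz : y m = z m)
    (hy : ∀ r ∈ Icc s m, HasDerivWithinAt y (M r (y r)) (Icc s m) r)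
    (hz : ∀ r ∈ Icc m t, HasDerivWithinAt z (M r (z r)) (Icc m t) r) :
    ∃ w : ℝ → E, w t = z t ∧
      ∀ r ∈ Icc s t, HasDerivWithinAt w (M r (w r)) (Icc s t) r := by
  classical
  set w : ℝ → E := fun r => if r < m then y r else z r with hw
  have hwy : ∀ r ∈ Icc s m, w r = y r := by
    intro r hr
    by_cases h : r < m
    · simp [hw, h]
    · have : r = m := le_antisymm hr.2 (not_lt.1 h)
      subst this
      simp [hw, hyz]
  have hwz : ∀ r ∈ Icc m t, w r = z r := by
    intro r hr
    simp [hw, not_lt.2 hr.1]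
  have h1 : ∀ r ∈ Icc s m, HasDerivWithinAt w (M r (w r)) (Icc s m) r := by
    intro r hr
    rw [hwy r hr]
    exact (hy r hr).congr hwy (hwy r hr)
  have h2 : ∀ r ∈ Icc m t, HasDerivWithinAt w (M r (w r)) (Icc m t) r := by
    intro r hr
    rw [hwz r hr]
    exact (hz r hr).congr hwz (hwz r hr)
  refine ⟨w, hwz t ⟨hmt, le_rfl⟩, ?_⟩
  intro r hr
  rcases lt_trichotomy r m with h | h | h
  · refine (h1 r ⟨hr.1, h.le⟩).mono_of_mem_nhdsWithin ?_
    have : Iio m ∈ 𝓝[Icc s t] r := mem_nhdsWithin_of_mem_nhds (Iio_mem_nhds h)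
    filter_upwards [this, self_mem_nhdsWithin] with q hq hq'
    exact ⟨hq'.1, le_of_lt hq⟩
  · subst h
    have := (h1 r ⟨hsm, le_rfl⟩).union (h2 r ⟨le_rfl, hmt⟩)
    rwa [Icc_union_Icc_eq_Icc hsm hmt] at this
  · refine (h2 r ⟨h.le, hr.2⟩).mono_of_mem_nhdsWithin ?_
    have : Ioi m ∈ 𝓝[Icc s t] r := mem_nhdsWithin_of_mem_nhds (Ioi_mem_nhds h)
    filter_upwards [this, self_mem_nhdsWithin] with q hq hq'
    exact ⟨le_of_lt hq, hq'.2⟩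

theorem linODE_exists {E : Type*} [NormedAddCommGroup E] [NormedSpace ℝ E] [CompleteSpace E]
    (M : ℝ → E →L[ℝ] E) (K : ℝ≥0) (n : ℕ) : ∀ (s t : ℝ), s ≤ t →
    ContinuousOn M (Icc s t) → (∀ r ∈ Icc s t, ‖M r‖ ≤ K) →
    (K : ℝ) * (t - s) ≤ n / 2 → ∀ x : E,
    ∃ y : ℝ → E, y t = x ∧ ∀ r ∈ Icc s t, HasDerivWithinAt y (M r (y r)) (Icc s t) r := by
  induction n with
  | zero =>
    intro s t hst hM hK hn x
    exact linODE_step M K s t hst hM hK (by norm_num at hn; linarith) x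
  | succ n ih =>
    intro s t hst hM hK hn x
    have hn0 : (0 : ℝ) < n + 1 := by positivity
    push_cast at hn
    set d : ℝ := (t - s) / (n + 1) with hd
    have hdn : d * (n + 1) = t - s := by rw [hd]; field_simp
    have hd0 : 0 ≤ d := div_nonneg (by linarith) hn0.le
    have hKd : (K : ℝ) * d ≤ 1 / 2 := by
      have : ((K : ℝ) * d) * (n + 1) ≤ 1 / 2 * (n + 1) := by rw [mul_assoc, hdn]; linarith
      exact le_of_mul_le_mul_right this hn0
    have hn1 : (0 : ℝ) ≤ n := by positivity
    have hsm : s ≤ s + d := by linarith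
    have hmt : s + d ≤ t := by nlinarith
    have sub1 : Icc s (s + d) ⊆ Icc s t := Icc_subset_Icc le_rfl hmt
    have sub2 : Icc (s + d) t ⊆ Icc s t := Icc_subset_Icc hsm le_rfl
    obtain ⟨z, hzt, hz⟩ := ih (s + d) t hmt (hM.mono sub2) (fun r hr => hK r (sub2 hr))
      (by
        have : t - (s + d) = d * n := by linarith
        rw [this]
        nlinarith) x
    obtain ⟨y, hym, hy⟩ := linODE_step M K s (s + d) hsm (hM.mono sub1)
      (fun r hr => hK r (sub1 hr)) (by simpa using hKd) (z (s + d))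
    obtain ⟨w, hwt, hw⟩ := linODE_glue M s (s + d) t hsm hmt y z hym hy hz
    exact ⟨w, hwt.trans hzt, hw⟩

/-- From a one-sided derivative within `Icc` to one within `Ici`. -/
theorem hasDerivWithinAt_Ici_of_Icc {E : Type*} [NormedAddCommGroup E] [NormedSpace ℝ E]
    {f : ℝ → E} {f' : E} {a c r : ℝ} (hr : r ∈ Ico a c)
    (h : HasDerivWithinAt f f' (Icc a c) r) : HasDerivWithinAt f f' (Ici r) r := by
  refine h.mono_of_mem_nhdsWithin ?_
  have : Iio c ∈ 𝓝[Ici r] r := mem_nhdsWithin_of_mem_nhds (Iio_mem_nhds hr.2)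
  filter_upwards [this, self_mem_nhdsWithin] with q hq hq'
  exact ⟨hr.1.trans hq', le_of_lt hq⟩

open scoped RealInnerProductSpace in
/-- If `T(t₀)` is injective (no monofocal point), then the range of `T(t₀)` has
trivial `B`-orthogonal complement; in particular if `B` is the inner product of
`H`, then the range of `T(t₀)` is dense in `H`. -/
theorem range_dense_of_not_monofocal
    {H : Type*} [NormedAddCommGroup H] [InnerProductSpace ℝ H] [CompleteSpace H]
    (B : H →L[ℝ] H →L[ℝ] ℝ)
    (hBsymm : ∀ x y : H, B x y = B y x)
    (hBpos : ∀ x : H, x ≠ 0 → 0 < B x x)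
    (b : ℝ) (hb : 0 < b)
    (R : ℝ → H →L[ℝ] H)
    (hRcont : ContinuousOn R (Icc 0 b))
    (hRsymm : ∀ t ∈ Icc (0:ℝ) b, ∀ x y : H, B (R t x) y = B x (R t y))
    (V W : Submodule ℝ H)
    (hVclosed : IsClosed (V : Set H)) (hWclosed : IsClosed (W : Set H))
    (hcompl : IsCompl V W)
    (hBorth : ∀ v ∈ V, ∀ w ∈ W, B v w = 0)
    (PV PW : H →L[ℝ] H)
    (hPV : ∀ x : H, PV x ∈ V) (hPW : ∀ x : H, PW x ∈ W)
    (hPVW : ∀ x : H, PV x + PW x = x)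
    (A : H →L[ℝ] H)
    (hArange : ∀ x : H, A x ∈ V) (hAW : ∀ w ∈ W, A w = 0)
    (hAsymm : ∀ x y : H, B (A x) y = B x (A y))
    (T T' T'' : ℝ → H →L[ℝ] H)
    (hT : IsNJacobiFlow b R PV PW A T T' T'')
    (t₀ : ℝ) (ht₀ : t₀ ∈ Ioc (0:ℝ) b)
    (hinj : Function.Injective (T t₀)) :
    (∀ u : H, (∀ z : H, B (T t₀ z) u = 0) → u = 0) ∧
    ((∀ x y : H, B x y = ⟪x, y⟫) → Dense (Set.range (T t₀))) := by
  have key : ∀ u : H, (∀ z : H, B (T t₀ z) u = 0) → u = 0 := by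
    intro u hu
    obtain ⟨hT1, hT2, -, hJ, hT0, hT0'⟩ := hT
    have ht0 : 0 ≤ t₀ := ht₀.1.le
    have hsub : Icc (0:ℝ) t₀ ⊆ Icc 0 b := Icc_subset_Icc le_rfl ht₀.2
    -- the first order system on `H × H`
    let M : ℝ → (H × H) →L[ℝ] (H × H) := fun t =>
      (ContinuousLinearMap.inl ℝ H H).comp (ContinuousLinearMap.snd ℝ H H)
      - (ContinuousLinearMap.inr ℝ H H).comp ((R t).comp (ContinuousLinearMap.fst ℝ H H))
    have hMapp : ∀ t (x : H × H), M t x = (x.2, - R t x.1) := by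
      intro t x
      simp [M]
    have hMc : ContinuousOn M (Icc 0 t₀) := by
      have hR' := hRcont.mono hsub
      exact continuousOn_const.sub (continuousOn_const.clm_comp (hR'.clm_comp continuousOn_const))
    have hMn : ContinuousOn (fun r => ‖M r‖) (Icc 0 t₀) := ContinuousOn.norm (E := (H × H) →L[ℝ] (H × H)) hMc
    obtain ⟨C, hC'⟩ := isCompact_Icc.bddAbove_image hMn
    have hC : ∀ r ∈ Icc 0 t₀, ‖M r‖ ≤ C := fun r hr => hC' ⟨r, hr, rfl⟩
    let K : ℝ≥0 := C.toNNReal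
    have hK : ∀ r ∈ Icc 0 t₀, ‖M r‖ ≤ K := fun r hr => (hC r hr).trans (Real.le_coe_toNNReal C)
    obtain ⟨n, hn⟩ := exists_nat_ge ((K : ℝ) * (t₀ - 0) * 2)
    obtain ⟨y, hyt, hy⟩ := linODE_exists M K n 0 t₀ ht0 hMc hK (by linarith) ((0 : H), u)
    have hy1 : ∀ r ∈ Icc 0 t₀, HasDerivWithinAt (fun r => (y r).1) (y r).2 (Icc 0 t₀) r := by
      intro r hr
      have h := (ContinuousLinearMap.fst ℝ H H).hasFDerivAt.comp_hasDerivWithinAt r (hy r hr)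
      simpa [hMapp, Function.comp_def] using h
    have hy2 : ∀ r ∈ Icc 0 t₀,
        HasDerivWithinAt (fun r => (y r).2) (- R r (y r).1) (Icc 0 t₀) r := by
      intro r hr
      have h := (ContinuousLinearMap.snd ℝ H H).hasFDerivAt.comp_hasDerivWithinAt r (hy r hr)
      simpa [hMapp, Function.comp_def] using h
    have hTz1 : ∀ z : H, ∀ r ∈ Icc 0 t₀,
        HasDerivWithinAt (fun r => T r z) (T' r z) (Icc 0 t₀) r := by
      intro z r hr
      have h := ((hT1 r (hsub hr)).mono hsub).clm_apply (hasDerivWithinAt_const r (Icc 0 t₀) z)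
      simpa using h
    have hTz2 : ∀ z : H, ∀ r ∈ Icc 0 t₀,
        HasDerivWithinAt (fun r => T' r z) (- R r (T r z)) (Icc 0 t₀) r := by
      intro z r hr
      have h := ((hT2 r (hsub hr)).mono hsub).clm_apply (hasDerivWithinAt_const r (Icc 0 t₀) z)
      have e : T'' r z = - R r (T r z) := by
        have := congrArg (fun L : H →L[ℝ] H => L z) (hJ r (hsub hr))
        simp only [add_apply, ContinuousLinearMap.comp_apply,
          zero_apply] at this
        exact eq_neg_of_add_eq_zero_left this
      rw [← e]
      simpa using h
    -- the Wronskian vanishes at `0`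
    have hWr : ∀ z : H, B (T 0 z) (y 0).2 - B (T' 0 z) (y 0).1 = 0 := by
      intro z
      have hd : ∀ r ∈ Icc 0 t₀,
          HasDerivWithinAt (fun r => B (T r z) (y r).2 - B (T' r z) (y r).1) 0 (Icc 0 t₀) r := by
        intro r hr
        have a1 := (B.hasFDerivAt.comp_hasDerivWithinAt r (hTz1 z r hr)).clm_apply (hy2 r hr)
        have a2 := (B.hasFDerivAt.comp_hasDerivWithinAt r (hTz2 z r hr)).clm_apply (hy1 r hr)
        have a3 := a1.sub a2
        refine a3.congr_deriv ?_
        have := hRsymm r (hsub hr) (T r z) (y r).1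
        simp [this]
        ring
      have hconst := constant_of_has_deriv_right_zero (fun r hr => (hd r hr).continuousWithinAt)
        (fun r hr => hasDerivWithinAt_Ici_of_Icc hr (hd r ⟨hr.1, hr.2.le⟩)) t₀ ⟨ht0, le_rfl⟩
      rw [← hconst]
      simp [hyt, hu z]
    have hPVv : ∀ v ∈ V, PV v = v ∧ PW v = 0 := by
      intro v hv
      have h1 : PW v ∈ V := by
        have : PW v = v - PV v := by rw [eq_sub_iff_add_eq, add_comm]; exact hPVW v
        rw [this]; exact V.sub_mem hv (hPV v)
      have h2 : PW v = 0 := Submodule.disjoint_def.1 hcompl.disjoint _ h1 (hPW v)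
      refine ⟨?_, h2⟩
      have := hPVW v
      rwa [h2, add_zero] at this
    have hPWw : ∀ w ∈ W, PV w = 0 ∧ PW w = w := by
      intro w hw
      have h1 : PV w ∈ W := by
        have : PV w = w - PW w := by rw [eq_sub_iff_add_eq]; exact hPVW w
        rw [this]; exact W.sub_mem hw (hPW w)
      have h2 : PV w = 0 := Submodule.disjoint_def.1 hcompl.disjoint _ (hPV w) h1
      refine ⟨h2, ?_⟩
      have := hPVW w
      rwa [h2, zero_add] at this
    have hzero : ∀ x : H, B x x = 0 → x = 0 := by
      intro x hx
      by_contra h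
      exact (hBpos x h).ne' hx
    rw [hT0, hT0'] at hWr
    -- `y 0` is tangential
    have hp : PW (y 0).1 = 0 := by
      apply hzero
      have h := hWr (PW (y 0).1)
      obtain ⟨e1, e2⟩ := hPWw _ (hPW (y 0).1)
      have e3 := hAW _ (hPW (y 0).1)
      simp only [add_apply, neg_apply, e1, e2, e3,
        map_zero, neg_zero, zero_add, zero_apply, zero_sub] at h
      have h' : B (PW (y 0).1) (y 0).1 = 0 := by linarith
      conv at h' => rw [← hPVW (y 0).1]
      have h5 := hBorth _ (hPV (y 0).1) _ (hPW (y 0).1)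
      rw [hBsymm] at h5
      rw [hPVW] at h'
      have h6 : B (PW (y 0).1) (PV (y 0).1 + PW (y 0).1) = 0 := by rw [hPVW]; exact h'
      rw [map_add, h5, zero_add] at h6
      exact h6
    have hp1 : PV (y 0).1 = (y 0).1 := by
      have := hPVW (y 0).1
      rwa [hp, add_zero] at this
    have hq : PV (y 0).2 + A (y 0).1 = 0 := by
      set v := PV (y 0).2 + A (y 0).1 with hv
      have hvV : v ∈ V := V.add_mem (hPV _) (hArange _)
      apply hzero
      have h := hWr v
      obtain ⟨e1, e2⟩ := hPVv v hvV
      simp only [add_apply, neg_apply, e1, e2,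
        add_zero, map_neg, sub_neg_eq_add] at h
      rw [hAsymm] at h
      have h5 := hBorth _ hvV _ (hPW (y 0).2)
      have h6 : B v (PV (y 0).2 + PW (y 0).2) + B v (A (y 0).1) = 0 := by rw [hPVW]; exact h
      rw [map_add, h5, add_zero, ← map_add] at h6
      exact h6
    -- `y` is the Jacobi field generated by `z`
    let z : H := (y 0).1 + PW (y 0).2
    have hz0 : PV z = (y 0).1 := by
      simp only [z, map_add, hp1, (hPWw _ (hPW (y 0).2)).1, add_zero]
    have hz1 : (-A + PW) z = (y 0).2 := by
      have e := hPVW (y 0).2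
      have e' : PV (y 0).2 = - A (y 0).1 := eq_neg_of_add_eq_zero_left hq
      simp only [z, add_apply, neg_apply, map_add, hp,
        (hPWw _ (hPW (y 0).2)).2, hAW _ (hPW (y 0).2), add_zero, neg_zero, zero_add]
      rw [← e', e]
    have hg : ∀ r ∈ Icc 0 t₀, HasDerivWithinAt (fun r => (T r z, T' r z))
        (M r (T r z, T' r z)) (Icc 0 t₀) r := by
      intro r hr
      rw [hMapp]
      exact (hTz1 z r hr).prodMk (hTz2 z r hr)
    have huniq : EqOn y (fun r => (T r z, T' r z)) (Icc 0 t₀) := by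
      refine ODE_solution_unique_of_mem_Icc_right (v := fun r x => M r x) (K := K)
        (s := fun _ => univ) ?_ (fun r hr => (hy r hr).continuousWithinAt)
        (fun r hr => hasDerivWithinAt_Ici_of_Icc hr (hy r ⟨hr.1, hr.2.le⟩)) (fun _ _ => trivial)
        (fun r hr => (hg r hr).continuousWithinAt)
        (fun r hr => hasDerivWithinAt_Ici_of_Icc hr (hg r ⟨hr.1, hr.2.le⟩)) (fun _ _ => trivial) ?_
      · intro r hr
        have h1 : ‖M r‖₊ ≤ K := hK r ⟨hr.1, hr.2.le⟩
        exact ((M r).lipschitz.weaken h1).lipschitzOnWith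
      · simp only [hT0, hT0', hz0, hz1]
    have hend := huniq (⟨ht0, le_rfl⟩ : t₀ ∈ Icc 0 t₀)
    rw [hyt] at hend
    have hTz : T t₀ z = 0 := (congrArg Prod.fst hend).symm
    have hzz : z = 0 := hinj (by rw [hTz, map_zero])
    have : u = T' t₀ z := congrArg Prod.snd hend
    rw [this, hzz, map_zero]
  refine ⟨key, ?_⟩
  intro hB
  have h1 : ((T t₀).toLinearMap.range)ᗮ = ⊥ := by
    rw [Submodule.eq_bot_iff]
    intro u hu
    apply key
    intro z
    rw [hB]
    exact (Submodule.mem_orthogonal _ u).1 hu _ ⟨z, rfl⟩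
  have h2 := Submodule.topologicalClosure_eq_top_iff.2 h1
  have h3 := Submodule.dense_iff_topologicalClosure_eq_top.2 h2
  exact h3
end

section
/- Let T be an N-Jacobi flow and let t₀ ∈ (0,b]. If T(t₀) is not injective, then T(t₀) is not surjective. (Every monofocal point of N along the geodesic is also an epifocal point.) -/
open Set

/-- If `T(t₀)` is not injective (a monofocal point), then `T(t₀)` is not
surjective (the point is also epifocal). -/
theorem not_surjective_of_not_injective
    {H : Type*} [NormedAddCommGroup H] [InnerProductSpace ℝ H] [CompleteSpace H]
    (B : H →L[ℝ] H →L[ℝ] ℝ)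
    (hBsymm : ∀ x y : H, B x y = B y x)
    (hBpos : ∀ x : H, x ≠ 0 → 0 < B x x)
    (b : ℝ) (hb : 0 < b)
    (R : ℝ → H →L[ℝ] H)
    (hRcont : ContinuousOn R (Icc 0 b))
    (hRsymm : ∀ t ∈ Icc (0:ℝ) b, ∀ x y : H, B (R t x) y = B x (R t y))
    (V W : Submodule ℝ H)
    (hVclosed : IsClosed (V : Set H)) (hWclosed : IsClosed (W : Set H))
    (hcompl : IsCompl V W)
    (hBorth : ∀ v ∈ V, ∀ w ∈ W, B v w = 0)
    (PV PW : H →L[ℝ] H)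
    (hPV : ∀ x : H, PV x ∈ V) (hPW : ∀ x : H, PW x ∈ W)
    (hPVW : ∀ x : H, PV x + PW x = x)
    (A : H →L[ℝ] H)
    (hArange : ∀ x : H, A x ∈ V) (hAW : ∀ w ∈ W, A w = 0)
    (hAsymm : ∀ x y : H, B (A x) y = B x (A y))
    (T T' T'' : ℝ → H →L[ℝ] H)
    (hT : IsNJacobiFlow b R PV PW A T T' T'')
    (t₀ : ℝ) (ht₀ : t₀ ∈ Ioc (0:ℝ) b)
    (hinj : ¬ Function.Injective (T t₀)) :
    ¬ Function.Surjective (T t₀) := by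
  obtain ⟨h1, h2, -, h3, hT0, hTd⟩ := hT
  intro hsurj
  apply hinj
  have ht : t₀ ∈ Icc (0:ℝ) b := ⟨ht₀.1.le, ht₀.2⟩
  have h0 : (0:ℝ) ∈ Icc (0:ℝ) b := ⟨le_rfl, hb.le⟩
  have e1 : ∀ x : H, ∀ t ∈ Icc (0:ℝ) b,
      HasDerivWithinAt (fun s => T s x) (T' t x) (Icc 0 b) t := by
    intro x t ht
    simpa using (h1 t ht).clm_apply (hasDerivWithinAt_const t (Icc 0 b) x)
  have e2 : ∀ x : H, ∀ t ∈ Icc (0:ℝ) b,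
      HasDerivWithinAt (fun s => T' s x) (-(R t (T t x))) (Icc 0 b) t := by
    intro x t ht
    have h := (h2 t ht).clm_apply (hasDerivWithinAt_const t (Icc 0 b) x)
    have h4 : T'' t x = -(R t (T t x)) := by
      have := congrArg (fun L : H →L[ℝ] H => L x) (h3 t ht)
      exact eq_neg_of_add_eq_zero_left (by simpa using this)
    simpa [h4] using h
  have eB : ∀ f g : ℝ → H, ∀ f' g' : H, ∀ t : ℝ, HasDerivWithinAt f f' (Icc 0 b) t →
      HasDerivWithinAt g g' (Icc 0 b) t →
      HasDerivWithinAt (fun s => B (f s) (g s)) (B f' (g t) + B (f t) g') (Icc 0 b) t := by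
    intro f g f' g' t hf hg
    have hBf : HasDerivWithinAt (fun s => B (f s)) (B f') (Icc 0 b) t :=
      B.hasFDerivAt.comp_hasDerivWithinAt t hf
    exact hBf.clm_apply hg
  have wr : ∀ x y : H, B (T t₀ x) (T' t₀ y) - B (T' t₀ x) (T t₀ y) = 0 := by
    intro x y
    have hd : ∀ t ∈ Icc (0:ℝ) b, HasDerivWithinAt
        (fun s => B (T s x) (T' s y) - B (T' s x) (T s y)) 0 (Icc 0 b) t := by
      intro t ht
      have h := (eB _ _ _ _ t (e1 x t ht) (e2 y t ht)).sub
        (eB _ _ _ _ t (e2 x t ht) (e1 y t ht))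
      refine h.congr_deriv ?_
      have := hRsymm t ht (T t x) (T t y)
      simp only [map_neg, neg_apply]
      linarith
    have hc := constant_of_has_deriv_right_zero
      (fun t ht => (hd t ht).continuousWithinAt)
      (fun t ht => (hd t ⟨ht.1, ht.2.le⟩).mono_of_mem_nhdsWithin
        (Icc_mem_nhdsGE_of_mem ht)) t₀ ht
    rw [hc, hT0, hTd]
    have hA : ∀ z, A z = A (PV z) := by
      intro z
      conv_lhs => rw [← hPVW z, map_add, hAW _ (hPW z), add_zero]
    have hB1 : ∀ z w, B (A z) w = B (A z) (PV w) := by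
      intro z w
      conv_lhs => rw [← hPVW w, map_add, hBorth _ (hArange z) _ (hPW w), add_zero]
    have a1 := hBorth _ (hPV x) _ (hPW y)
    have a2 := hBorth _ (hPV y) _ (hPW x)
    rw [hBsymm] at a2
    have a3 : B (PV x) (A y) = B (A x) (PV y) := by
      rw [← hAsymm, ← hA, hB1]
    simp only [add_apply, neg_apply, map_add, map_neg, a1, a2, a3]
    ring
  rw [injective_iff_map_eq_zero]
  intro x hx
  have hx' : T' t₀ x = 0 := by
    by_contra hne
    obtain ⟨y, hy⟩ := hsurj (T' t₀ x)
    have h := wr x y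
    rw [hx, hy] at h
    have := hBpos _ hne
    simp at h
    linarith
  obtain ⟨C, hC⟩ := isCompact_Icc.exists_bound_of_continuousOn hRcont
  have hlip : ∀ t ∈ Ioc (0:ℝ) t₀, LipschitzOnWith (max 1 C.toNNReal)
      (fun p : H × H => (p.2, -(R t p.1))) univ := by
    intro t ht
    have hR : LipschitzWith C.toNNReal (R t) := by
      refine (R t).lipschitz.weaken ?_
      rw [← NNReal.coe_le_coe, coe_nnnorm]
      exact (hC t ⟨ht.1.le, ht.2.trans ht₀.2⟩).trans (Real.le_coe_toNNReal C)
    have hRn : LipschitzWith C.toNNReal (fun p : H × H => -(R t p.1)) := by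
      have := (hR.comp (LipschitzWith.prod_fst (α := H) (β := H))).neg
      rw [mul_one] at this
      exact this
    exact ((LipschitzWith.prod_snd (α := H) (β := H)).prodMk hRn).lipschitzOnWith
  have hu := ODE_solution_unique_of_mem_Icc_left
    (f := fun t => (T t x, T' t x)) (g := fun _ => (0 : H × H))
    (s := fun _ => univ) (a := 0) (b := t₀) hlip
    (fun t ht => ((e1 x t ⟨ht.1, ht.2.trans ht₀.2⟩).continuousWithinAt.prodMk
      (e2 x t ⟨ht.1, ht.2.trans ht₀.2⟩).continuousWithinAt).mono
        (Icc_subset_Icc_right ht₀.2))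
    (fun t ht => ((e1 x t ⟨ht.1.le, ht.2.trans ht₀.2⟩).prodMk
      (e2 x t ⟨ht.1.le, ht.2.trans ht₀.2⟩)).mono_of_mem_nhdsWithin
        (Icc_mem_nhdsLE_of_mem ⟨ht.1, ht.2.trans ht₀.2⟩))
    (fun _ _ => mem_univ _)
    continuousOn_const
    (fun t _ => (hasDerivWithinAt_const t (Iic t) (0 : H × H)).congr_deriv (by simp; rfl))
    (fun _ _ => mem_univ _)
    (by simp [hx, hx'])
  have hz := hu (⟨le_rfl, ht₀.1.le⟩ : (0:ℝ) ∈ Icc 0 t₀)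
  simp only [hT0, hTd, Prod.mk_eq_zero] at hz
  obtain ⟨z1, z2⟩ := hz
  have z3 : PW x = x := by simpa [z1] using hPVW x
  have z4 : A x = 0 := hAW x (z3 ▸ hPW x)
  simpa [z3, z4] using z2
end

section
/- Let 0 < t₀ ≤ b, let T be a point Jacobi flow on [0,t₀] and let T̃ be the reversed flow on [0,t₀]. Then T(t₀) is injective if and only if T̃(t₀) is injective. (The point c(t₀) is monoconjugate to c(0) along the geodesic c if and only if c(0) is monoconjugate to c(t₀) along the reversed geodesic.) -/
open Set

/-- `T` is a point Jacobi flow on `[0,t₀]` for `R`: `T'' + R ∘ T = 0`,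
`T 0 = 0`, `T' 0 = id`. -/
def IsPointJacobiFlow {H : Type*} [NormedAddCommGroup H] [InnerProductSpace ℝ H]
    (t₀ : ℝ) (R : ℝ → H →L[ℝ] H) (T T' T'' : ℝ → H →L[ℝ] H) : Prop :=
  (∀ t ∈ Icc (0:ℝ) t₀, HasDerivWithinAt T (T' t) (Icc 0 t₀) t) ∧
  (∀ t ∈ Icc (0:ℝ) t₀, HasDerivWithinAt T' (T'' t) (Icc 0 t₀) t) ∧
  ContinuousOn T'' (Icc 0 t₀) ∧
  (∀ t ∈ Icc (0:ℝ) t₀, T'' t + (R t).comp (T t) = 0) ∧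
  T 0 = 0 ∧ T' 0 = ContinuousLinearMap.id ℝ H

/-- `S` is the reversed point Jacobi flow on `[0,t₀]`: `S'' t + R(t₀−t) ∘ S t = 0`,
`S 0 = 0`, `S' 0 = id`. -/
def IsReversedPointFlow {H : Type*} [NormedAddCommGroup H] [InnerProductSpace ℝ H]
    (t₀ : ℝ) (R : ℝ → H →L[ℝ] H) (S S' S'' : ℝ → H →L[ℝ] H) : Prop :=
  (∀ t ∈ Icc (0:ℝ) t₀, HasDerivWithinAt S (S' t) (Icc 0 t₀) t) ∧
  (∀ t ∈ Icc (0:ℝ) t₀, HasDerivWithinAt S' (S'' t) (Icc 0 t₀) t) ∧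
  ContinuousOn S'' (Icc 0 t₀) ∧
  (∀ t ∈ Icc (0:ℝ) t₀, S'' t + (R (t₀ - t)).comp (S t) = 0) ∧
  S 0 = 0 ∧ S' 0 = ContinuousLinearMap.id ℝ H

lemma jacobi_zero_aux {H : Type*} [NormedAddCommGroup H] [NormedSpace ℝ H]
    (t₀ : ℝ) (ht : 0 < t₀) (A : ℝ → H →L[ℝ] H) (hA : ContinuousOn A (Icc 0 t₀))
    (u u' : ℝ → H)
    (hu : ∀ t ∈ Icc (0:ℝ) t₀, HasDerivWithinAt u (u' t) (Icc 0 t₀) t)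
    (hu' : ∀ t ∈ Icc (0:ℝ) t₀, HasDerivWithinAt u' (-(A t (u t))) (Icc 0 t₀) t)
    (h0 : u 0 = 0) (h0' : u' 0 = 0) : u t₀ = 0 ∧ u' t₀ = 0 := by
  obtain ⟨K, hK⟩ := isCompact_Icc.exists_bound_of_continuousOn hA
  have key := norm_le_gronwallBound_of_norm_deriv_right_le
    (f := fun t => (u t, u' t)) (f' := fun t => (u' t, -(A t (u t)))) (δ := 0)
    (K := max 1 K) (ε := 0) (a := 0) (b := t₀)
    (fun t h => ((hu t h).continuousWithinAt).prodMk ((hu' t h).continuousWithinAt))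
    (fun t h => by
      have hm : t ∈ Icc 0 t₀ := ⟨h.1, h.2.le⟩
      have hd := (hu t hm).prodMk (hu' t hm)
      exact hd.mono_of_mem_nhdsWithin (Icc_mem_nhdsGE_of_mem h))
    (by simp [h0, h0'])
    (fun t h => by
      have hm : t ∈ Icc 0 t₀ := ⟨h.1, h.2.le⟩
      have h1 : ‖A t (u t)‖ ≤ K * ‖u t‖ := (A t).le_of_opNorm_le (hK t hm) _
      have a1 : ‖u t‖ ≤ ‖(u t, u' t)‖ := norm_fst_le (u t, u' t)
      have a2 : ‖u' t‖ ≤ ‖(u t, u' t)‖ := norm_snd_le (u t, u' t)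
      have hp : 0 ≤ ‖(u t, u' t)‖ := norm_nonneg _
      rw [add_zero]
      refine (norm_prod_le_iff).2 ⟨?_, ?_⟩
      · calc ‖u' t‖ ≤ 1 * ‖(u t, u' t)‖ := by rw [one_mul]; exact a2
          _ ≤ _ := mul_le_mul_of_nonneg_right (le_max_left _ _) hp
      · rw [norm_neg]
        calc ‖A t (u t)‖ ≤ K * ‖u t‖ := h1
          _ ≤ max 1 K * ‖u t‖ := mul_le_mul_of_nonneg_right (le_max_right _ _) (norm_nonneg _)
          _ ≤ _ := mul_le_mul_of_nonneg_left a1 (by positivity))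
    t₀ ⟨ht.le, le_rfl⟩
  simp only [gronwallBound_ε0, zero_mul] at key
  have := norm_le_zero_iff.1 key
  exact Prod.mk_eq_zero.1 this

lemma jacobi_inj_aux {H : Type*} [NormedAddCommGroup H] [InnerProductSpace ℝ H]
    (t₀ : ℝ) (ht : 0 < t₀) (R A : ℝ → H →L[ℝ] H) (hA : ContinuousOn A (Icc 0 t₀))
    (hRA : ∀ t ∈ Icc (0:ℝ) t₀, R (t₀ - t) = A t)
    (T T' T'' : ℝ → H →L[ℝ] H) (hT : IsPointJacobiFlow t₀ R T T' T'')
    (S S' S'' : ℝ → H →L[ℝ] H) (hS : IsPointJacobiFlow t₀ A S S' S'')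
    (hinj : Function.Injective (S t₀)) : Function.Injective (T t₀) := by
  obtain ⟨hT1, hT2, -, hT3, hT0, hT0'⟩ := hT
  obtain ⟨hS1, hS2, -, hS3, hS0, hS0'⟩ := hS
  rw [injective_iff_map_eq_zero]
  intro x hx
  have hmap : MapsTo (fun s : ℝ => t₀ - s) (Icc 0 t₀) (Icc 0 t₀) :=
    fun s hs => ⟨by linarith [hs.2], by linarith [hs.1]⟩
  have hrev : ∀ (F F' : ℝ → H →L[ℝ] H),
      (∀ t ∈ Icc (0:ℝ) t₀, HasDerivWithinAt F (F' t) (Icc 0 t₀) t) →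
      ∀ t ∈ Icc (0:ℝ) t₀,
        HasDerivWithinAt (fun s => F (t₀ - s) x) (-(F' (t₀ - t) x)) (Icc 0 t₀) t := by
    intro F F' hF t h
    have h1 : HasDerivWithinAt (fun s : ℝ => t₀ - s) (-1) (Icc 0 t₀) t :=
      (hasDerivWithinAt_id t _).const_sub t₀
    have h2 := (hF (t₀ - t) (hmap h)).scomp t h1 hmap
    have h3 := h2.clm_apply (hasDerivWithinAt_const t _ x)
    simpa using h3
  set y := T' t₀ x with hy
  have hfw : ∀ (F F' : ℝ → H →L[ℝ] H),
      (∀ t ∈ Icc (0:ℝ) t₀, HasDerivWithinAt F (F' t) (Icc 0 t₀) t) →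
      ∀ t ∈ Icc (0:ℝ) t₀,
        HasDerivWithinAt (fun s => F s y) (F' t y) (Icc 0 t₀) t := by
    intro F F' hF t h
    simpa using (hF t h).clm_apply (hasDerivWithinAt_const t _ y)
  have key := jacobi_zero_aux t₀ ht A hA
    (fun s => T (t₀ - s) x + S s y) (fun s => -(T' (t₀ - s) x) + S' s y)
    (fun t h => (hrev T T' hT1 t h).add (hfw S S' hS1 t h))
    (fun t h => by
      have h1 := (hrev T' T'' hT2 t h).neg.add (hfw S' S'' hS2 t h)
      have e1 : T'' (t₀ - t) x + A t (T (t₀ - t) x) = 0 := by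
        have := DFunLike.congr_fun (hT3 _ (hmap h)) x
        simpa [hRA t h] using this
      have e2 : S'' t y + A t (S t y) = 0 := by
        simpa using DFunLike.congr_fun (hS3 _ h) y
      refine HasDerivWithinAt.congr_deriv (f := fun s => -(T' (t₀ - s) x) + S' s y) h1 ?_
      rw [map_add, eq_neg_of_add_eq_zero_left e1, eq_neg_of_add_eq_zero_left e2]
      abel)
    (by simp [hx, hS0]) (by simp [hS0', hy])
  obtain ⟨k1, k2⟩ := key
  simp only [sub_self, hT0, hT0', ContinuousLinearMap.zero_apply, zero_add,
    ContinuousLinearMap.id_apply] at k1 k2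
  have y0 : y = 0 := hinj (by rw [k1, map_zero])
  simpa [y0] using k2

/-- `c(t₀)` is monoconjugate to `c(0)` iff `c(0)` is monoconjugate to `c(t₀)`
along the reversed geodesic: `T(t₀)` is injective iff `T̃(t₀)` is injective. -/
theorem monoconjugate_symm
    {H : Type*} [NormedAddCommGroup H] [InnerProductSpace ℝ H] [CompleteSpace H]
    (B : H →L[ℝ] H →L[ℝ] ℝ)
    (hBsymm : ∀ x y : H, B x y = B y x)
    (hBpos : ∀ x : H, x ≠ 0 → 0 < B x x)
    (b : ℝ) (hb : 0 < b)
    (R : ℝ → H →L[ℝ] H)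
    (hRcont : ContinuousOn R (Icc 0 b))
    (hRsymm : ∀ t ∈ Icc (0:ℝ) b, ∀ x y : H, B (R t x) y = B x (R t y))
    (t₀ : ℝ) (ht₀ : t₀ ∈ Ioc (0:ℝ) b)
    (T T' T'' : ℝ → H →L[ℝ] H)
    (hT : IsPointJacobiFlow t₀ R T T' T'')
    (S S' S'' : ℝ → H →L[ℝ] H)
    (hS : IsReversedPointFlow t₀ R S S' S'') :
    Function.Injective (T t₀) ↔ Function.Injective (S t₀) := by
  have hR : ContinuousOn R (Icc 0 t₀) := hRcont.mono (Icc_subset_Icc_right ht₀.2)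
  have hR' : ContinuousOn (fun t => R (t₀ - t)) (Icc 0 t₀) :=
    hR.comp (by fun_prop) (fun s hs => ⟨by linarith [hs.2], by linarith [hs.1]⟩)
  exact ⟨jacobi_inj_aux t₀ ht₀.1 (fun t => R (t₀ - t)) R hR (fun t _ => by simp)
      S S' S'' hS T T' T'' hT,
    jacobi_inj_aux t₀ ht₀.1 R (fun t => R (t₀ - t)) hR' (fun t _ => rfl)
      T T' T'' hT S S' S'' hS⟩
end

section
/- Assume B is the inner product of the Hilbert space H. Let 0 < t₀ ≤ b, let T be a point Jacobi flow on [0,t₀] and let T̃ be the reversed flow on [0,t₀]. If T(t₀) is not surjective and the range of T(t₀) is a closed subspace of H, then T̃(t₀) is not injective. (If c(t₀) is an epiconjugate point of c(0) with closed image of the differential, then c(0) is monoconjugate to c(t₀) along the reversed geodesic.) -/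
open Set
open scoped RealInnerProductSpace

/-- In the Riemannian case (`B` is the inner product of `H`): if `T(t₀)` is not
surjective and its range is closed, then the reversed flow `T̃(t₀)` is not
injective. -/
theorem reversed_not_injective_of_epiconjugate_closed_range
    {H : Type*} [NormedAddCommGroup H] [InnerProductSpace ℝ H] [CompleteSpace H]
    (b : ℝ) (hb : 0 < b)
    (R : ℝ → H →L[ℝ] H)
    (hRcont : ContinuousOn R (Icc 0 b))
    (hRsymm : ∀ t ∈ Icc (0:ℝ) b, ∀ x y : H, ⟪R t x, y⟫ = ⟪x, R t y⟫)
    (t₀ : ℝ) (ht₀ : t₀ ∈ Ioc (0:ℝ) b)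
    (T T' T'' : ℝ → H →L[ℝ] H)
    (hT : IsPointJacobiFlow t₀ R T T' T'')
    (S S' S'' : ℝ → H →L[ℝ] H)
    (hS : IsReversedPointFlow t₀ R S S' S'')
    (hnsurj : ¬ Function.Surjective (T t₀))
    (hclosed : IsClosed (Set.range (T t₀))) :
    ¬ Function.Injective (S t₀) := by
  obtain ⟨hT1, hT2, -, hT3, hT0, hT0'⟩ := hT
  obtain ⟨hS1, hS2, -, hS3, hS0, hS0'⟩ := hS
  have h0 : (0:ℝ) ≤ t₀ := ht₀.1.le
  have key : ∀ x y : H, ⟪T t₀ x, y⟫ = ⟪x, S t₀ y⟫ := by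
    intro x y
    have hmaps : MapsTo (fun t : ℝ => t₀ - t) (Icc 0 t₀) (Icc 0 t₀) := by
      intro t ht
      exact ⟨by linarith [ht.2], by linarith [ht.1]⟩
    have ev : ∀ (F : ℝ → H →L[ℝ] H) (F' : H →L[ℝ] H) (t : ℝ) (z : H),
        HasDerivWithinAt F F' (Icc 0 t₀) t →
        HasDerivWithinAt (fun s => F s z) (F' z) (Icc 0 t₀) t := by
      intro F F' t z h
      simpa using h.clm_apply (hasDerivWithinAt_const t (Icc 0 t₀) z)
    have rev : ∀ (F : ℝ → H →L[ℝ] H) (F' : H →L[ℝ] H) (t : ℝ) (z : H),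
        t ∈ Icc 0 t₀ → HasDerivWithinAt F F' (Icc 0 t₀) (t₀ - t) →
        HasDerivWithinAt (fun s => F (t₀ - s) z) (-(F' z)) (Icc 0 t₀) t := by
      intro F F' t z ht h
      have h1 : HasDerivWithinAt (fun s : ℝ => t₀ - s) (-1) (Icc 0 t₀) t :=
        ((hasDerivAt_id t).const_sub t₀).hasDerivWithinAt
      have h2 := (ev F F' (t₀ - t) z h).scomp t h1 hmaps
      simpa [Function.comp_def] using h2
    let W : ℝ → ℝ := fun t => ⟪T' t x, S (t₀ - t) y⟫ + ⟪T t x, S' (t₀ - t) y⟫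
    have hW : ∀ t ∈ Icc (0:ℝ) t₀, HasDerivWithinAt W 0 (Icc 0 t₀) t := by
      intro t ht
      have hr := hmaps ht
      have a1 := ev _ _ t x (hT1 t ht)
      have a2 := ev _ _ t x (hT2 t ht)
      have b1 := rev _ _ t y ht (hS1 _ hr)
      have b2 := rev _ _ t y ht (hS2 _ hr)
      have e1 : T'' t x = -(R t (T t x)) := by
        have := congrArg (fun L : H →L[ℝ] H => L x) (hT3 t ht)
        exact eq_neg_of_add_eq_zero_left (by simpa using this)
      have e2 : S'' (t₀ - t) y = -(R t (S (t₀ - t) y)) := by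
        have := congrArg (fun L : H →L[ℝ] H => L y) (hS3 _ hr)
        exact eq_neg_of_add_eq_zero_left (by simpa using this)
      have h := (a2.inner ℝ b1).add (a1.inner ℝ b2)
      refine h.congr_deriv ?_
      rw [e1, e2]
      simp only [inner_neg_left, inner_neg_right]
      rw [hRsymm t ⟨ht.1, ht.2.trans ht₀.2⟩]
      ring
    have hc : W t₀ = W 0 := by
      apply constant_of_has_deriv_right_zero (a := 0) (b := t₀)
        (fun t ht => (hW t ht).continuousWithinAt) _ t₀ ⟨h0, le_rfl⟩
      intro t ht
      exact (hW t ⟨ht.1, ht.2.le⟩).mono_of_mem_nhdsWithin (Icc_mem_nhdsGE_of_mem ht)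
    simpa [W, hT0, hT0', hS0, hS0'] using hc
  intro hinj
  apply hnsurj
  have hcl : IsClosed ((LinearMap.range (T t₀ : H →ₗ[ℝ] H) : Submodule ℝ H) : Set H) := by
    rw [LinearMap.coe_range]; exact hclosed
  have : CompleteSpace (LinearMap.range (T t₀ : H →ₗ[ℝ] H)) := hcl.completeSpace_coe
  have htop : LinearMap.range (T t₀ : H →ₗ[ℝ] H) = ⊤ := by
    rw [← Submodule.orthogonal_eq_bot_iff, Submodule.eq_bot_iff]
    intro y hy
    apply hinj
    rw [map_zero]
    apply ext_inner_left ℝ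
    intro x
    rw [← key, inner_zero_right]
    exact (Submodule.mem_orthogonal _ y).1 hy _ ⟨x, rfl⟩
  exact LinearMap.range_eq_top.1 htop
end

section
/- (Hypersurface comparison, first part) Assume W is one-dimensional (V has codimension one). Let A and Ā be two Weingarten operators as in the context satisfying B((A − Ā)v, v) > 0 for every nonzero v ∈ V, and let T and T̄ be N-Jacobi flows with initial data determined by A and Ā respectively (T(0) = T̄(0) = P_V, T'(0) = −A + P_W, T̄'(0) = −Ā + P_W). If T(t) is invertible for every t ∈ (0,b), then T̄(t) is injective for every t ∈ (0,b). -/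
open Set

open Filter Topology

lemma hsc_tend {E F : Type*} [NormedAddCommGroup E] [NormedSpace ℝ E]
    [NormedAddCommGroup F] [NormedSpace ℝ F] {l : Filter ℝ} {L : ℝ → E →L[ℝ] F} {L₀ : E →L[ℝ] F}
    {g : ℝ → E} {g₀ : E} (hL : Tendsto L l (𝓝 L₀)) (hg : Tendsto g l (𝓝 g₀)) :
    Tendsto (fun t => L t (g t)) l (𝓝 (L₀ g₀)) :=
  ((isBoundedBilinearMap_apply (𝕜 := ℝ) (E := E) (F := F)).continuous.tendsto (L₀, g₀)).comp
    (hL.prodMk_nhds hg)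

lemma hsc_bilin {H : Type*} [NormedAddCommGroup H] [InnerProductSpace ℝ H]
    (B : H →L[ℝ] H →L[ℝ] ℝ) {f g : ℝ → H} {f' g' : H} {s : Set ℝ} {t : ℝ}
    (hf : HasDerivWithinAt f f' s t) (hg : HasDerivWithinAt g g' s t) :
    HasDerivWithinAt (fun t => B (f t) (g t)) (B f' (g t) + B (f t) g') s t :=
  (B.hasFDerivAt.comp_hasDerivWithinAt t hf).clm_apply hg

lemma hsc_apply {H : Type*} [NormedAddCommGroup H] [InnerProductSpace ℝ H]
    {T : ℝ → H →L[ℝ] H} {T' : H →L[ℝ] H} {s : Set ℝ} {t : ℝ}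
    (hf : HasDerivWithinAt T T' s t) (x : H) :
    HasDerivWithinAt (fun t => T t x) (T' x) s t := by
  simpa using hf.clm_apply (hasDerivWithinAt_const t s x)

/-- Lagrangian condition. -/
lemma hsc_lagr {H : Type*} [NormedAddCommGroup H] [InnerProductSpace ℝ H]
    (B : H →L[ℝ] H →L[ℝ] ℝ)
    (hBsymm : ∀ x y : H, B x y = B y x)
    (b : ℝ)
    (R : ℝ → H →L[ℝ] H)
    (hRsymm : ∀ t ∈ Icc (0:ℝ) b, ∀ x y : H, B (R t x) y = B x (R t y))
    (V W : Submodule ℝ H)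
    (hBorth : ∀ v ∈ V, ∀ w ∈ W, B v w = 0)
    (PV PW : H →L[ℝ] H)
    (hPV : ∀ x : H, PV x ∈ V) (hPW : ∀ x : H, PW x ∈ W)
    (hPVW : ∀ x : H, PV x + PW x = x)
    (A : H →L[ℝ] H)
    (hArange : ∀ x : H, A x ∈ V)
    (hAsymm : ∀ x y : H, B (A x) y = B x (A y))
    (T T' T'' : ℝ → H →L[ℝ] H)
    (hT : IsNJacobiFlow b R PV PW A T T' T'') (t : ℝ) (ht : t ∈ Icc 0 b) (x y : H) :
    B (T' t x) (T t y) = B (T t x) (T' t y) := by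
  obtain ⟨h1, h2, -, h4, h5, h6⟩ := hT
  have hT2 : ∀ s ∈ Icc 0 b, ∀ z, T'' s z = - R s (T s z) := fun s hs z => by
    have := congrArg (fun L => L z) (h4 s hs)
    simp at this
    exact eq_neg_of_add_eq_zero_left this
  have hd : ∀ s ∈ Icc 0 b, HasDerivWithinAt
      (fun s => B (T' s x) (T s y) - B (T s x) (T' s y)) 0 (Icc 0 b) s := by
    intro s hs
    have := (hsc_bilin B (hsc_apply (h2 s hs) x) (hsc_apply (h1 s hs) y)).sub
      (hsc_bilin B (hsc_apply (h1 s hs) x) (hsc_apply (h2 s hs) y))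
    refine this.congr_deriv ?_
    rw [hT2 s hs, hT2 s hs]
    simp [hRsymm s hs]
    ring
  have hb0 : (0:ℝ) ∈ Icc 0 b := ⟨le_rfl, ht.1.trans ht.2⟩
  have hc := (convex_Icc (0:ℝ) b).norm_image_sub_le_of_norm_hasDerivWithin_le (C := 0)
    hd (by simp) hb0 ht
  simp only [zero_mul, norm_le_zero_iff, h5, h6] at hc
  have e1 : ∀ x y, B (A x) (PV y) = B (A x) y := fun x y => by
    conv_rhs => rw [← hPVW y]
    rw [map_add, hBorth _ (hArange x) _ (hPW y), add_zero]
  have e2 : B (PW x) (PV y) = 0 := by rw [hBsymm]; exact hBorth _ (hPV y) _ (hPW x)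
  have e3 : B (PV x) (PW y) = 0 := hBorth _ (hPV x) _ (hPW y)
  have e4 : B (PV x) (A y) = B (A x) y := by rw [hBsymm, e1, hAsymm, hBsymm]
  simp [e1, e2, e3, e4] at hc
  linarith

/-- Uniqueness. -/
lemma hsc_unique {H : Type*} [NormedAddCommGroup H] [InnerProductSpace ℝ H]
    (b : ℝ) (R : ℝ → H →L[ℝ] H) (hRcont : ContinuousOn R (Icc 0 b))
    (J J' J'' : ℝ → H)
    (h1 : ∀ t ∈ Icc (0:ℝ) b, HasDerivWithinAt J (J' t) (Icc 0 b) t)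
    (h2 : ∀ t ∈ Icc (0:ℝ) b, HasDerivWithinAt J' (J'' t) (Icc 0 b) t)
    (h4 : ∀ t ∈ Icc (0:ℝ) b, J'' t = - R t (J t))
    (h5 : J 0 = 0) (h6 : J' 0 = 0) : ∀ t ∈ Icc (0:ℝ) b, J t = 0 := by
  obtain ⟨K, hK⟩ := isCompact_Icc.exists_bound_of_continuousOn hRcont
  intro t ht
  have hd : ∀ s ∈ Icc 0 b, HasDerivWithinAt (fun s => (J s, J' s)) (J' s, J'' s) (Icc 0 b) s :=
    fun s hs => (h1 s hs).prodMk (h2 s hs)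
  have := norm_le_gronwallBound_of_norm_deriv_right_le (f := fun s => (J s, J' s))
    (f' := fun s => (J' s, J'' s)) (δ := 0) (K := max 1 K) (ε := 0) (a := 0) (b := b)
    (fun s hs => (hd s hs).continuousWithinAt)
    (fun s hs => (hd s (Ico_subset_Icc_self hs)).mono_of_mem_nhdsWithin
      (mem_of_superset (Icc_mem_nhdsGE hs.2) (Icc_subset_Icc_left hs.1)))
    (by simp [h5, h6])
    (fun s hs => by
      have hs' := Ico_subset_Icc_self hs
      have n1 : ‖J s‖ ≤ ‖(J s, J' s)‖ := norm_fst_le (J s, J' s)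
      have n2 : ‖J' s‖ ≤ ‖(J s, J' s)‖ := norm_snd_le (J s, J' s)
      have n0 := norm_nonneg (J s, J' s)
      rw [add_zero, Prod.norm_def (J' s, J'' s)]
      refine max_le ?_ ?_
      · calc ‖J' s‖ ≤ 1 * ‖(J s, J' s)‖ := by simpa using n2
          _ ≤ _ := by gcongr; exact le_max_left _ _
      · show ‖J'' s‖ ≤ _
        rw [h4 s hs', norm_neg]
        calc ‖R s (J s)‖ ≤ ‖R s‖ * ‖J s‖ := (R s).le_opNorm _
          _ ≤ max 1 K * ‖(J s, J' s)‖ := by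
            gcongr
            exact (hK s hs').trans (le_max_right _ _))
    t ht
  rw [gronwallBound_ε0_δ0] at this
  have := norm_le_zero_iff.1 this
  exact (Prod.mk.inj this).1

/-- Asymptotics of `C = T⁻¹ Tbar x` at zero. -/
lemma hsc_limit {H : Type*} [NormedAddCommGroup H] [InnerProductSpace ℝ H] [CompleteSpace H]
    (b : ℝ) (hb : 0 < b) (PV PW D : H →L[ℝ] H) (hPWPV : PW * PV = 0) (hPWPW : PW * PW = PW)
    (hPVPV : PV * PV = PV) (hPVPW : PV * PW = 0) (hsum : PV + PW = 1)
    (T : ℝ → H →L[ℝ] H) (hT0 : T 0 = PV) (hd : HasDerivWithinAt T D (Ici 0) 0)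
    (hD : D * PW = PW)
    (hu : ∀ t ∈ Ioo 0 b, IsUnit (T t)) (x : H) (Y : ℝ → H) (Y' : H) (hY0 : Y 0 = PV x)
    (hY : HasDerivWithinAt Y Y' (Ici 0) 0) (hv : PW (D x - Y') = 0) :
    Tendsto (fun t => Ring.inverse (T t) (Y t)) (𝓝[>] 0) (𝓝 x) := by
  have hslope : Tendsto (fun t => t⁻¹ • (T t - PV)) (𝓝[>] 0) (𝓝 D) := by
    have := (hasDerivWithinAt_iff_tendsto_slope' (by simp)).1 (hd.mono Ioi_subset_Ici_self)
    refine this.congr fun t => ?_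
    simp [slope_def_module, hT0]
  have hslope2 : Tendsto (fun t => t⁻¹ • (T t x - Y t)) (𝓝[>] 0) (𝓝 (D x - Y')) := by
    have := (hasDerivWithinAt_iff_tendsto_slope' (by simp)).1
      (((hsc_apply hd x).sub hY).mono Ioi_subset_Ici_self)
    refine this.congr fun t => ?_
    simp [slope_def_module, hT0, hY0]
  have hTt : Tendsto T (𝓝[>] 0) (𝓝 PV) := by
    rw [← hT0]
    exact hd.continuousWithinAt.mono Ioi_subset_Ici_self
  have hQ : Tendsto (fun t => T t * PV + (t⁻¹ • (T t - PV)) * PW) (𝓝[>] 0) (𝓝 1) := by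
    have := (hTt.mul_const PV).add (hslope.mul_const PW)
    rwa [hPVPV, hD, hsum] at this
  have hE : Tendsto (fun t => Ring.inverse (T t * PV + (t⁻¹ • (T t - PV)) * PW))
      (𝓝[>] 0) (𝓝 1) := by
    have := (NormedRing.inverse_continuousAt (1 : (H →L[ℝ] H)ˣ)).tendsto
    simp only [Units.val_one, Ring.inverse_one] at this
    exact this.comp hQ
  have hQu : ∀ᶠ t in 𝓝[>] (0:ℝ), IsUnit (T t * PV + (t⁻¹ • (T t - PV)) * PW) :=
    hQ.eventually (Units.isOpen.mem_nhds isUnit_one)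
  have hid : Tendsto (fun t : ℝ => t) (𝓝[>] 0) (𝓝 0) := tendsto_id.mono_left nhdsWithin_le_nhds
  have hM : Tendsto (fun t : ℝ => t • PV + PW) (𝓝[>] 0) (𝓝 PW) := by
    simpa using (hid.smul_const PV).add_const PW
  have hF : Tendsto (fun t : ℝ => x - ((t • PV + PW) *
      Ring.inverse (T t * PV + (t⁻¹ • (T t - PV)) * PW)) (t⁻¹ • (T t x - Y t))) (𝓝[>] 0) (𝓝 x) := by
    have := (hsc_tend (hM.mul hE) hslope2).const_sub x
    simpa [hv] using this
  refine hF.congr' ?_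
  filter_upwards [hQu, Ioo_mem_nhdsGT hb] with t hq ht
  have ht0 : t ≠ 0 := ht.1.ne'
  have hTu := hu t ht
  set Q := T t * PV + (t⁻¹ • (T t - PV)) * PW with hQdef
  have hQ2 : T t * (PV + t⁻¹ • PW) = Q := by
    rw [hQdef]
    simp [mul_add, sub_mul, hPVPW]
  have hS : (PV + t⁻¹ • PW) * Ring.inverse Q = Ring.inverse (T t) := by
    calc (PV + t⁻¹ • PW) * Ring.inverse Q
        = (Ring.inverse (T t) * T t) * (PV + t⁻¹ • PW) * Ring.inverse Q := by
          rw [Ring.inverse_mul_cancel _ hTu, one_mul]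
      _ = Ring.inverse (T t) * (Q * Ring.inverse Q) := by rw [← hQ2]; simp only [mul_assoc]
      _ = _ := by rw [Ring.mul_inverse_cancel _ hq, mul_one]
  have hM2 : t • PV + PW = t • (PV + t⁻¹ • PW) := by
    rw [smul_add, smul_smul, mul_inv_cancel₀ ht0, one_smul]
  rw [hM2, smul_mul_assoc, hS]
  have hTx : Ring.inverse (T t) (T t x) = x := by
    have := congrArg (fun L => L x) (Ring.inverse_mul_cancel _ hTu)
    simpa using this
  simp [smul_smul, ht0, hTx]

/-- (Hypersurface comparison, first part) If `W` is one-dimensional, the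
Weingarten operators satisfy `B((A − Ā)v, v) > 0` for nonzero `v ∈ V`, and the
`N`-Jacobi flow `T` for `A` is invertible on `(0,b)`, then the `N`-Jacobi flow
`T̄` for `Ā` is injective on `(0,b)`. -/
theorem hypersurface_comparison_injective
    {H : Type*} [NormedAddCommGroup H] [InnerProductSpace ℝ H] [CompleteSpace H]
    (B : H →L[ℝ] H →L[ℝ] ℝ)
    (hBsymm : ∀ x y : H, B x y = B y x)
    (hBpos : ∀ x : H, x ≠ 0 → 0 < B x x)
    (b : ℝ) (hb : 0 < b)
    (R : ℝ → H →L[ℝ] H)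
    (hRcont : ContinuousOn R (Icc 0 b))
    (hRsymm : ∀ t ∈ Icc (0:ℝ) b, ∀ x y : H, B (R t x) y = B x (R t y))
    (V W : Submodule ℝ H)
    (hVclosed : IsClosed (V : Set H)) (hWclosed : IsClosed (W : Set H))
    (hcompl : IsCompl V W)
    (hdim : Module.finrank ℝ W = 1)
    (hBorth : ∀ v ∈ V, ∀ w ∈ W, B v w = 0)
    (PV PW : H →L[ℝ] H)
    (hPV : ∀ x : H, PV x ∈ V) (hPW : ∀ x : H, PW x ∈ W)
    (hPVW : ∀ x : H, PV x + PW x = x)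
    (A Abar : H →L[ℝ] H)
    (hArange : ∀ x : H, A x ∈ V) (hAW : ∀ w ∈ W, A w = 0)
    (hAsymm : ∀ x y : H, B (A x) y = B x (A y))
    (hAbarRange : ∀ x : H, Abar x ∈ V) (hAbarW : ∀ w ∈ W, Abar w = 0)
    (hAbarSymm : ∀ x y : H, B (Abar x) y = B x (Abar y))
    (hpos : ∀ v ∈ V, v ≠ 0 → 0 < B ((A - Abar) v) v)
    (T T' T'' : ℝ → H →L[ℝ] H)
    (hT : IsNJacobiFlow b R PV PW A T T' T'')
    (Tbar Tbar' Tbar'' : ℝ → H →L[ℝ] H)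
    (hTbar : IsNJacobiFlow b R PV PW Abar Tbar Tbar' Tbar'')
    (hTbij : ∀ t ∈ Ioo (0:ℝ) b, Function.Bijective (T t)) :
    ∀ t ∈ Ioo (0:ℝ) b, Function.Injective (Tbar t) := by
  have hPVw : ∀ x ∈ W, PV x = 0 := fun x hx => by
    have h1 : PV x ∈ W := by
      rw [eq_sub_of_add_eq (hPVW x)]; exact W.sub_mem hx (hPW x)
    exact Submodule.disjoint_def.1 hcompl.disjoint _ (hPV x) h1
  have hPWv : ∀ x ∈ V, PW x = 0 := fun x hx => by
    have h1 : PW x ∈ V := by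
      rw [eq_sub_of_add_eq' (hPVW x)]; exact V.sub_mem hx (hPV x)
    exact Submodule.disjoint_def.1 hcompl.disjoint _ h1 (hPW x)
  have hPVv : ∀ x ∈ V, PV x = x := fun x hx => by simpa [hPWv x hx] using hPVW x
  have hPWw : ∀ x ∈ W, PW x = x := fun x hx => by simpa [hPVw x hx] using hPVW x
  have hlag := hsc_lagr B hBsymm b R hRsymm V W hBorth PV PW hPV hPW hPVW A hArange hAsymm
    T T' T'' hT
  obtain ⟨h1, h2, -, h4, h5, h6⟩ := hT
  obtain ⟨k1, k2, -, k4, k5, k6⟩ := hTbar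
  have hT2 : ∀ s ∈ Icc 0 b, ∀ z, T'' s z = - R s (T s z) := fun s hs z => by
    have := congrArg (fun L => L z) (h4 s hs)
    simp at this
    exact eq_neg_of_add_eq_zero_left this
  have hK2 : ∀ s ∈ Icc 0 b, ∀ z, Tbar'' s z = - R s (Tbar s z) := fun s hs z => by
    have := congrArg (fun L => L z) (k4 s hs)
    simp at this
    exact eq_neg_of_add_eq_zero_left this
  have h00 : (0:ℝ) ∈ Icc 0 b := ⟨le_rfl, hb.le⟩
  have hu : ∀ t ∈ Ioo 0 b, IsUnit (T t) := fun t ht =>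
    ContinuousLinearMap.isUnit_iff_bijective.2 (hTbij t ht)
  intro t₀ ht₀
  rw [injective_iff_map_eq_zero]
  intro x hx
  by_contra hx0
  by_cases hxV : PV x = 0
  · -- `x ∈ W`
    have hxW : x ∈ W := by
      have := hPVW x
      rw [hxV, zero_add] at this
      rw [← this]; exact hPW x
    have := hsc_unique b R hRcont (fun t => T t x - Tbar t x) (fun t => T' t x - Tbar' t x)
      (fun t => T'' t x - Tbar'' t x)
      (fun t ht => (hsc_apply (h1 t ht) x).sub (hsc_apply (k1 t ht) x))
      (fun t ht => (hsc_apply (h2 t ht) x).sub (hsc_apply (k2 t ht) x))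
      (fun t ht => by
        show T'' t x - Tbar'' t x = _
        rw [hT2 t ht, hK2 t ht, map_sub]; abel)
      (by simp [h5, k5]) (by simp [h6, k6, hAW x hxW, hAbarW x hxW]) t₀ (Ioo_subset_Icc_self ht₀)
    simp only [hx, sub_zero] at this
    exact hx0 ((hTbij t₀ ht₀).1 (by rw [this, map_zero]))
  -- main case
  let S : ℝ → H →L[ℝ] H := fun t => Ring.inverse (T t)
  let C : ℝ → H := fun t => S t (Tbar t x)
  let Z : ℝ → H := fun t => Tbar' t x - T' t (C t)
  let f : ℝ → ℝ := fun t => B (Z t) (Tbar t x)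
  have hTS : ∀ t ∈ Ioo 0 b, ∀ z, T t (S t z) = z := fun t ht z => by
    have := congrArg (fun L => L z) (Ring.mul_inverse_cancel _ (hu t ht))
    simpa using this
  have hnhds : ∀ t ∈ Ioo 0 b, Icc 0 b ∈ 𝓝 t := fun t ht => Icc_mem_nhds ht.1 ht.2
  have hfd : ∀ t ∈ Ioo 0 b, HasDerivAt f (B (Z t) (Z t)) t := by
    intro t ht
    have hti := Ioo_subset_Icc_self ht
    have dT := (h1 t hti).hasDerivAt (hnhds t ht)
    have dT' := (h2 t hti).hasDerivAt (hnhds t ht)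
    have dY := (hsc_apply (k1 t hti) x).hasDerivAt (hnhds t ht)
    have dY' := (hsc_apply (k2 t hti) x).hasDerivAt (hnhds t ht)
    obtain ⟨u, huu⟩ := hu t ht
    have hSu : S t = ↑u⁻¹ := by
      show Ring.inverse (T t) = _
      rw [← huu, Ring.inverse_unit]
    have dS : HasDerivAt S (-(S t * T' t * S t)) t := by
      have hF := hasFDerivAt_ringInverse (𝕜 := ℝ) u
      rw [huu] at hF
      have := hF.comp_hasDerivAt t dT
      rw [hSu]
      refine this.congr_deriv ?_
      simp
    have dC := dS.clm_apply dY
    have dZ := dY'.sub (dT'.clm_apply dC)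
    have df := hsc_bilin B dZ.hasDerivWithinAt dY.hasDerivWithinAt (s := univ)
    rw [hasDerivWithinAt_univ] at df
    refine df.congr_deriv ?_
    set c := C t with hc
    have hcS : S t (Tbar t x) = c := rfl
    have hYc : T t c = Tbar t x := hTS t ht _
    have hc' : (-(S t * T' t * S t)) (Tbar t x) + S t (Tbar' t x) = S t (Z t) := by
      simp [Z, hcS, ← hc]; abel
    rw [hc', hcS]
    have hZ' : Tbar'' t x - (T'' t c + T' t (S t (Z t))) = - T' t (S t (Z t)) := by
      rw [hT2 t hti, hK2 t hti, hYc]; abel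
    rw [hZ']
    have hYd : Tbar' t x = Z t + T' t c := by simp [Z, ← hc]
    have hl := hlag t hti (S t (Z t)) c
    rw [hYc, hTS t ht] at hl
    simp only [Pi.sub_apply, hcS]
    have e : B (Z t) (Tbar' t x) = B (Z t) (Z t) + B (Z t) (T' t c) := by
      rw [hYd, map_add]
    have e2 : B (Tbar' t x - T' t c) (Tbar' t x) = B (Z t) (Tbar' t x) := rfl
    rw [e2, e, map_neg, ContinuousLinearMap.neg_apply, hl]
    ring
  have hBnn : ∀ z, 0 ≤ B z z := fun z => by
    by_cases hz : z = 0
    · simp [hz]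
    · exact (hBpos z hz).le
  have hmono : MonotoneOn f (Ioo 0 b) := by
    refine monotoneOn_of_deriv_nonneg (convex_Ioo _ _)
      (fun t ht => (hfd t ht).continuousAt.continuousWithinAt) ?_ ?_
    · rw [interior_Ioo]
      exact fun t ht => (hfd t ht).differentiableAt.differentiableWithinAt
    · rw [interior_Ioo]
      intro t ht
      rw [(hfd t ht).deriv]; exact hBnn _
  have hf0 : f t₀ = 0 := by simp [f, hx]
  have hloc : ∀ {E : Type _} [NormedAddCommGroup E] [NormedSpace ℝ E] {g : ℝ → E} {g' : E},
      HasDerivWithinAt g g' (Icc 0 b) 0 → HasDerivWithinAt g g' (Ici 0) 0 :=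
    fun h => h.mono_of_mem_nhdsWithin (Icc_mem_nhdsGE hb)
  have hAPW : ∀ z, A (PW z) = 0 := fun z => hAW _ (hPW z)
  have hC : Tendsto C (𝓝[>] 0) (𝓝 x) := by
    refine hsc_limit b hb PV PW (T' 0) ?_ ?_ ?_ ?_ ?_ T h5 (hloc (h1 0 h00)) ?_ hu x
      (fun t => Tbar t x) (Tbar' 0 x) (by simp [k5]) (hloc (hsc_apply (k1 0 h00) x)) ?_
    · ext z; simp [hPWv _ (hPV z)]
    · ext z; simp [hPWw _ (hPW z)]
    · ext z; simp [hPVv _ (hPV z)]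
    · ext z; simp [hPVw _ (hPW z)]
    · ext z; simp [hPVW]
    · ext z; simp [h6, hAPW, hPWw _ (hPW z)]
    · simp [h6, k6, hPWv _ (hArange x), hPWv _ (hAbarRange x)]
  have hle : Ioi (0:ℝ) ⊆ Ici 0 := Ioi_subset_Ici_self
  have lY : Tendsto (fun t => Tbar t x) (𝓝[>] 0) (𝓝 (Tbar 0 x)) :=
    (hloc (hsc_apply (k1 0 h00) x)).continuousWithinAt.mono hle
  have lY' : Tendsto (fun t => Tbar' t x) (𝓝[>] 0) (𝓝 (Tbar' 0 x)) :=
    (hloc (hsc_apply (k2 0 h00) x)).continuousWithinAt.mono hle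
  have lT' : Tendsto T' (𝓝[>] 0) (𝓝 (T' 0)) :=
    (hloc (h2 0 h00)).continuousWithinAt.mono hle
  have lZ : Tendsto Z (𝓝[>] 0) (𝓝 (Tbar' 0 x - T' 0 x)) := lY'.sub (hsc_tend lT' hC)
  have lf : Tendsto f (𝓝[>] 0) (𝓝 (B (Tbar' 0 x - T' 0 x) (Tbar 0 x))) :=
    hsc_tend ((B.continuous.tendsto _).comp lZ) lY
  have hlim : B (Tbar' 0 x - T' 0 x) (Tbar 0 x) ≤ 0 := by
    refine le_of_tendsto lf ?_
    filter_upwards [Ioo_mem_nhdsGT ht₀.1] with t ht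
    rw [← hf0]
    exact hmono ⟨ht.1, ht.2.trans ht₀.2⟩ ht₀ ht.2.le
  have hp := hpos (PV x) (hPV x) hxV
  have hAx : A x = A (PV x) := by
    conv_lhs => rw [← hPVW x, map_add, hAPW, add_zero]
  have hAbx : Abar x = Abar (PV x) := by
    conv_lhs => rw [← hPVW x, map_add, hAbarW _ (hPW x), add_zero]
  have : Tbar' 0 x - T' 0 x = (A - Abar) (PV x) := by
    simp [h6, k6, ← hAx, ← hAbx]; abel
  rw [this, k5] at hlim
  exact absurd hp (not_lt.2 hlim)
end

section
/- (Hypersurface comparison, second part, Riemannian case) Assume B is the inner product of the Hilbert space H and that W is one-dimensional. Let A and Ā be two Weingarten operators with ⟨(A − Ā)v, v⟩ > 0 for every nonzero v ∈ V and such that A − Ā restricts to an invertible operator on V, and let T and T̄ be the N-Jacobi flows with initial data determined by A and Ā respectively. If T(t) is invertible for every t ∈ (0,b), then T̄(t) is invertible for every t ∈ (0,b). -/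
open Set

section Aux

open Filter Topology
open scoped RealInnerProductSpace

lemma aux_coercive {H : Type*} [NormedAddCommGroup H] [InnerProductSpace ℝ H] [CompleteSpace H]
    (M : H →L[ℝ] H) (hs : ∀ x y, ⟪M x, y⟫ = ⟪x, M y⟫) (hp : ∀ x, 0 ≤ ⟪M x, x⟫)
    (hb : Function.Bijective M) : ∃ c : ℝ, 0 < c ∧ ∀ x, c * ‖x‖ ^ 2 ≤ ⟪M x, x⟫ := by
  let e : H ≃L[ℝ] H := ContinuousLinearEquiv.ofBijective M
    (LinearMap.ker_eq_bot.2 hb.1) (LinearMap.range_eq_top.2 hb.2)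
  have he : ∀ x, e x = M x := fun x => rfl
  set K : ℝ := ‖(e.symm : H →L[ℝ] H)‖
  have hK : ∀ x, ‖x‖ ≤ K * ‖M x‖ := by
    intro x
    have := (e.symm : H →L[ℝ] H).le_opNorm (M x)
    have h2 : e.symm (M x) = x := e.symm_apply_apply x
    simpa [h2] using this
  have hM : ∀ x, ‖M x‖ ^ 2 ≤ ‖M‖ * ⟪M x, x⟫ := by
    intro x
    have key : ∀ y, ⟪M x, y⟫ ^ 2 ≤ ⟪M x, x⟫ * ⟪M y, y⟫ := by
      intro y
      have h := discrim_le_zero (a := ⟪M y, y⟫) (b := 2 * ⟪M x, y⟫) (c := ⟪M x, x⟫) (by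
        intro r
        have := hp (x + r • y)
        simp only [map_add, map_smul, inner_add_left, inner_add_right, inner_smul_left,
          inner_smul_right] at this
        have h2 : ⟪M y, x⟫ = ⟪M x, y⟫ := by rw [hs, real_inner_comm]
        rw [h2] at this
        simp at this
        nlinarith)
      unfold discrim at h
      nlinarith
    have h1 := key (M x)
    rw [real_inner_self_eq_norm_sq] at h1
    have h2 : ⟪M (M x), M x⟫ ≤ ‖M‖ * ‖M x‖ ^ 2 := by
      have := real_inner_le_norm (M (M x)) (M x)
      have h3 := M.le_opNorm (M x)
      nlinarith [norm_nonneg (M x)]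
    rcases eq_or_ne (‖M x‖ ^ 2) 0 with h0 | h0
    · rw [h0]; exact mul_nonneg (norm_nonneg _) (hp x)
    · have hpos : 0 < ‖M x‖ ^ 2 := lt_of_le_of_ne (by positivity) (Ne.symm h0)
      have := mul_le_mul_of_nonneg_left h2 (hp x)
      nlinarith
  refine ⟨1 / (K ^ 2 * ‖M‖ + 1), by positivity, fun x => ?_⟩
  rw [div_mul_eq_mul_div, one_mul, div_le_iff₀ (by positivity)]
  have h1 : ‖x‖ ^ 2 ≤ (K * ‖M x‖) ^ 2 := by
    gcongr; exact hK x
  have h2 := mul_le_mul_of_nonneg_left (hM x) (sq_nonneg K)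
  nlinarith [hp x]

lemma aux_bij {H : Type*} [NormedAddCommGroup H] [InnerProductSpace ℝ H] [CompleteSpace H]
    (M : H →L[ℝ] H) (c : ℝ) (hc : 0 < c) (h : ∀ x, c * ‖x‖ ^ 2 ≤ ⟪M x, x⟫) :
    Function.Bijective M := by
  let B : H →L[ℝ] H →L[ℝ] ℝ := (innerSL ℝ).comp M
  have hB : IsCoercive B := ⟨c, hc, fun x => by
    have := h x
    simpa [B, pow_two, mul_assoc] using this⟩
  have : (M : H → H) = hB.continuousLinearEquivOfBilin := by
    ext x
    exact hB.unique_continuousLinearEquivOfBilin (fun w => by simp [B])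
  rw [this]
  exact hB.continuousLinearEquivOfBilin.bijective

lemma aux_mono {b : ℝ} (f f' : ℝ → ℝ) (L : ℝ)
    (hd : ∀ t ∈ Ioo 0 b, HasDerivAt f (f' t) t) (h0 : ∀ t ∈ Ioo 0 b, 0 ≤ f' t)
    (hl : Tendsto f (𝓝[>] 0) (𝓝 L)) : ∀ t ∈ Ioo 0 b, L ≤ f t := by
  intro t ht
  have hm : MonotoneOn f (Ioo 0 b) := by
    refine monotoneOn_of_hasDerivWithinAt_nonneg (f' := f') (convex_Ioo 0 b)
      (fun y hy ↦ (hd y hy).continuousAt.continuousWithinAt)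
      (fun y hy ↦ (hd y (interior_subset hy)).hasDerivWithinAt)
      (fun y hy ↦ h0 y (interior_subset hy))
  refine le_of_tendsto hl ?_
  filter_upwards [Ioo_mem_nhdsGT ht.1] with s hs
  exact hm ⟨hs.1, hs.2.trans ht.2⟩ ht hs.2.le

lemma aux_wronskian {H : Type*} [NormedAddCommGroup H] [InnerProductSpace ℝ H]
    (b : ℝ) (R : ℝ → H →L[ℝ] H)
    (hRsymm : ∀ t ∈ Icc (0:ℝ) b, ∀ x y : H, ⟪R t x, y⟫ = ⟪x, R t y⟫)
    {PV PW A₁ A₂ : H →L[ℝ] H} {T T' T'' S S' S'' : ℝ → H →L[ℝ] H}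
    (hT : IsNJacobiFlow b R PV PW A₁ T T' T'')
    (hS : IsNJacobiFlow b R PV PW A₂ S S' S'') (x y : H) :
    ∀ t ∈ Icc (0:ℝ) b, ⟪T t x, S' t y⟫ - ⟪T' t x, S t y⟫ =
      ⟪PV x, (-A₂ + PW) y⟫ - ⟪(-A₁ + PW) x, PV y⟫ := by
  obtain ⟨hT1, hT2, -, hT3, hT4, hT5⟩ := hT
  obtain ⟨hS1, hS2, -, hS3, hS4, hS5⟩ := hS
  have hd : ∀ t ∈ Icc (0:ℝ) b, HasDerivWithinAt
      (fun t => ⟪T t x, S' t y⟫ - ⟪T' t x, S t y⟫) 0 (Icc 0 b) t := by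
    intro t ht
    have a1 := (hT1 t ht).clm_apply (hasDerivWithinAt_const t (Icc 0 b) x)
    have a2 := (hT2 t ht).clm_apply (hasDerivWithinAt_const t (Icc 0 b) x)
    have a3 := (hS1 t ht).clm_apply (hasDerivWithinAt_const t (Icc 0 b) y)
    have a4 := (hS2 t ht).clm_apply (hasDerivWithinAt_const t (Icc 0 b) y)
    have h := (a1.inner ℝ a4).sub (a2.inner ℝ a3)
    refine h.congr_deriv ?_
    have e1 : T'' t x = - R t (T t x) := by
      have := congrArg (fun f : H →L[ℝ] H => f x) (hT3 t ht)
      exact eq_neg_of_add_eq_zero_left (by simpa using this)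
    have e2 : S'' t y = - R t (S t y) := by
      have := congrArg (fun f : H →L[ℝ] H => f y) (hS3 t ht)
      exact eq_neg_of_add_eq_zero_left (by simpa using this)
    simp [e1, e2, hRsymm t ht]
    ring
  intro t ht
  have := constant_of_has_deriv_right_zero (fun t ht => (hd t ht).continuousWithinAt)
    (fun t ht => (hd t ⟨ht.1, ht.2.le⟩).mono_of_mem_nhdsWithin (Icc_mem_nhdsGE_of_mem ht)) t ht
  rw [this, hT4, hT5, hS4, hS5]

lemma aux_lim {H : Type*} [NormedAddCommGroup H] [InnerProductSpace ℝ H] [CompleteSpace H]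
    (PV PW A D : H →L[ℝ] H) (hPVW : PV + PW = 1) (hPVV : PV * PV = PV)
    (hVW : PV * PW = 0) (hAPW : A * PW = 0) (hWD : PW * D = 0) (hWW : PW * PW = PW)
    (T Tb : ℝ → H →L[ℝ] H) (hT0 : T 0 = PV) (hTb0 : Tb 0 = PV)
    (hT : HasDerivWithinAt T (-A + PW) (Ioi 0) 0)
    (hTb : HasDerivWithinAt Tb (-(A - D) + PW) (Ioi 0) 0)
    (hu : ∀ᶠ t in 𝓝[>] (0:ℝ), IsUnit (T t)) :
    Tendsto (fun t => Ring.inverse (T t) * Tb t) (𝓝[>] 0) (𝓝 1) := by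
  let Z : ℝ → H →L[ℝ] H := fun t => PV + t⁻¹ • PW
  have sl : ∀ {F : ℝ → H →L[ℝ] H} {F' : H →L[ℝ] H}, HasDerivWithinAt F F' (Ioi 0) 0 →
      Tendsto (fun t => t⁻¹ • (F t - F 0)) (𝓝[>] 0) (𝓝 F') := by
    intro F F' hF
    have := (hasDerivWithinAt_iff_tendsto_slope' (by simp)).1 hF
    simpa [slope_fun_def] using this
  have tT : Tendsto T (𝓝[>] 0) (𝓝 PV) := hT0 ▸ hT.continuousWithinAt.tendsto
  have tTb : Tendsto Tb (𝓝[>] 0) (𝓝 PV) := hTb0 ▸ hTb.continuousWithinAt.tendsto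
  have hTZ : Tendsto (fun t => T t * Z t) (𝓝[>] 0) (𝓝 1) := by
    have h1 := (tT.mul_const PV).add ((sl hT).mul_const PW)
    have e : PV * PV + (-A + PW) * PW = 1 := by
      rw [add_mul, neg_mul, hAPW, hPVV, hWW, neg_zero, zero_add, hPVW]
    rw [e] at h1
    refine h1.congr fun t => ?_
    rw [hT0, smul_mul_assoc, sub_mul, hVW, sub_zero]
    simp only [Z, mul_add, mul_smul_comm]
  have hI : Tendsto (fun t => Ring.inverse (T t * Z t)) (𝓝[>] 0) (𝓝 1) := by
    have := (NormedRing.inverse_continuousAt (1 : (H →L[ℝ] H)ˣ)).tendsto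
    simp only [Units.val_one, Ring.inverse_one] at this
    exact this.comp hTZ
  have huZ : ∀ᶠ t in 𝓝[>] (0:ℝ), IsUnit (T t * Z t) :=
    hTZ.eventually (Units.isOpen.mem_nhds isUnit_one)
  have hE : Tendsto (fun t => Tb t - T t) (𝓝[>] 0) (𝓝 0) := by
    simpa using tTb.sub tT
  have hE' : Tendsto (fun t => t⁻¹ • (Tb t - T t)) (𝓝[>] 0) (𝓝 D) := by
    have := (sl hTb).sub (sl hT)
    have e : -(A - D) + PW - (-A + PW) = D := by abel
    rw [e] at this
    refine this.congr fun t => ?_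
    rw [← smul_sub, hT0, hTb0]
    congr 1
    abel
  have hfin : Tendsto (fun t => 1 + (PV * (Ring.inverse (T t * Z t) * (Tb t - T t)) +
      PW * (Ring.inverse (T t * Z t) * (t⁻¹ • (Tb t - T t))))) (𝓝[>] 0) (𝓝 1) := by
    have := ((hI.mul hE).const_mul PV).add ((hI.mul hE').const_mul PW)
    have := this.const_add 1
    simpa [hWD] using this
  refine hfin.congr' ?_
  filter_upwards [hu, huZ] with t h1 h2
  have h3 : Ring.inverse (T t) = Z t * Ring.inverse (T t * Z t) := by
    have h4 := Ring.mul_inverse_cancel _ h2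
    calc Ring.inverse (T t) = Ring.inverse (T t) * (T t * Z t * Ring.inverse (T t * Z t)) := by
          rw [h4, mul_one]
      _ = (Ring.inverse (T t) * T t) * (Z t * Ring.inverse (T t * Z t)) := by
          simp only [mul_assoc]
      _ = _ := by rw [Ring.inverse_mul_cancel _ h1, one_mul]
  have h5 : Ring.inverse (T t) * Tb t = 1 + Ring.inverse (T t) * (Tb t - T t) := by
    rw [mul_sub, Ring.inverse_mul_cancel _ h1]; abel
  rw [h5, h3]
  simp only [Z, add_mul, smul_mul_assoc, mul_smul_comm, mul_assoc]

end Aux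

open scoped RealInnerProductSpace in
/-- (Hypersurface comparison, second part, Riemannian case) If `B` is the inner
product of `H`, `W` is one-dimensional, `⟪(A − Ā)v, v⟫ > 0` for nonzero `v ∈ V`,
`A − Ā` restricts to an invertible operator on `V`, and the `N`-Jacobi flow `T`
for `A` is invertible on `(0,b)`, then the `N`-Jacobi flow `T̄` for `Ā` is
invertible on `(0,b)`. -/
theorem hypersurface_comparison_invertible
    {H : Type*} [NormedAddCommGroup H] [InnerProductSpace ℝ H] [CompleteSpace H]
    (b : ℝ) (hb : 0 < b)
    (R : ℝ → H →L[ℝ] H)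
    (hRcont : ContinuousOn R (Icc 0 b))
    (hRsymm : ∀ t ∈ Icc (0:ℝ) b, ∀ x y : H, ⟪R t x, y⟫ = ⟪x, R t y⟫)
    (V W : Submodule ℝ H)
    (hVclosed : IsClosed (V : Set H)) (hWclosed : IsClosed (W : Set H))
    (hcompl : IsCompl V W)
    (hdim : Module.finrank ℝ W = 1)
    (horth : ∀ v ∈ V, ∀ w ∈ W, ⟪v, w⟫ = 0)
    (PV PW : H →L[ℝ] H)
    (hPV : ∀ x : H, PV x ∈ V) (hPW : ∀ x : H, PW x ∈ W)
    (hPVW : ∀ x : H, PV x + PW x = x)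
    (A Abar : H →L[ℝ] H)
    (hArange : ∀ x : H, A x ∈ V) (hAW : ∀ w ∈ W, A w = 0)
    (hAsymm : ∀ x y : H, ⟪A x, y⟫ = ⟪x, A y⟫)
    (hAbarRange : ∀ x : H, Abar x ∈ V) (hAbarW : ∀ w ∈ W, Abar w = 0)
    (hAbarSymm : ∀ x y : H, ⟪Abar x, y⟫ = ⟪x, Abar y⟫)
    (hpos : ∀ v ∈ V, v ≠ 0 → 0 < ⟪(A - Abar) v, v⟫)
    (hinvV : Set.BijOn (fun x => (A - Abar) x) (V : Set H) (V : Set H))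
    (T T' T'' : ℝ → H →L[ℝ] H)
    (hT : IsNJacobiFlow b R PV PW A T T' T'')
    (Tbar Tbar' Tbar'' : ℝ → H →L[ℝ] H)
    (hTbar : IsNJacobiFlow b R PV PW Abar Tbar Tbar' Tbar'')
    (hTbij : ∀ t ∈ Ioo (0:ℝ) b, Function.Bijective (T t)) :
    ∀ t ∈ Ioo (0:ℝ) b, Function.Bijective (Tbar t) := by
  -- algebra of the projections
  have hPWV : ∀ v ∈ V, PW v = 0 := by
    intro v hv
    have h1 : PW v ∈ V := by
      have : PW v = v - PV v := eq_sub_of_add_eq' (hPVW v)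
      rw [this]; exact V.sub_mem hv (hPV v)
    exact (Submodule.disjoint_def.1 hcompl.disjoint) _ h1 (hPW v)
  have hPVv : ∀ v ∈ V, PV v = v := by
    intro v hv
    have := hPVW v
    rwa [hPWV v hv, add_zero] at this
  have hPVw : ∀ w ∈ W, PV w = 0 := by
    intro w hw
    have h1 : PV w ∈ W := by
      have : PV w = w - PW w := eq_sub_of_add_eq (hPVW w)
      rw [this]; exact W.sub_mem hw (hPW w)
    exact (Submodule.disjoint_def.1 hcompl.disjoint) _ (hPV w) h1
  have hPWw : ∀ w ∈ W, PW w = w := by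
    intro w hw
    have := hPVW w
    rwa [hPVw w hw, zero_add] at this
  set D : H →L[ℝ] H := A - Abar with hD
  have hDV : ∀ x, D x ∈ V := fun x => V.sub_mem (hArange x) (hAbarRange x)
  have hDW : ∀ w ∈ W, D w = 0 := fun w hw => by simp [hD, hAW w hw, hAbarW w hw]
  have hDP : ∀ x, D x = D (PV x) := fun x => by
    conv_lhs => rw [← hPVW x, map_add, hDW _ (hPW x), add_zero]
  have hDs : ∀ x y, ⟪D x, y⟫ = ⟪x, D y⟫ := fun x y => by
    simp [hD, inner_sub_left, inner_sub_right, hAsymm, hAbarSymm]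
  have hVPW : ∀ v ∈ V, ∀ x, ⟪v, PV x⟫ = ⟪v, x⟫ := fun v hv x => by
    conv_rhs => rw [← hPVW x, inner_add_right, horth v hv _ (hPW x), add_zero]
  have hWPV : ∀ w ∈ W, ∀ x, ⟪w, PW x⟫ = ⟪w, x⟫ := fun w hw x => by
    conv_rhs => rw [← hPVW x, inner_add_right, real_inner_comm, horth _ (hPV x) w hw, zero_add]
  have hDx : ∀ x, ⟪D x, x⟫ = ⟪D (PV x), PV x⟫ := fun x => by
    rw [← hDP, hVPW _ (hDV x)]
  have hDnn : ∀ x, 0 ≤ ⟪D x, x⟫ := fun x => by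
    rw [hDx]
    rcases eq_or_ne (PV x) 0 with h | h
    · simp [h]
    · exact (hpos _ (hPV x) h).le
  have hPWx : ∀ x, ⟪PW x, x⟫ = ‖PW x‖ ^ 2 := fun x => by
    rw [← real_inner_self_eq_norm_sq, hWPV _ (hPW x)]
  have hDker : ∀ x, D x = 0 → x ∈ W := fun x hx => by
    by_contra hne
    have h1 : PV x ≠ 0 := fun h => hne (by
      have := hPVW x
      rw [h, zero_add] at this
      exact this ▸ hPW x)
    have h2 := hpos _ (hPV x) h1
    rw [← hDx, hx, inner_zero_left] at h2
    exact lt_irrefl _ h2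
  -- coercivity of `D + PW`
  obtain ⟨c, hc, hcoer⟩ : ∃ c : ℝ, 0 < c ∧ ∀ x, c * ‖x‖ ^ 2 ≤ ⟪(D + PW) x, x⟫ := by
    apply aux_coercive
    · intro x y
      have : ⟪PW x, y⟫ = ⟪x, PW y⟫ := by
        rw [← hWPV _ (hPW x), real_inner_comm, hWPV _ (hPW y), real_inner_comm]
      simp [inner_add_left, inner_add_right, hDs, this]
    · intro x
      rw [ContinuousLinearMap.add_apply, inner_add_left, hPWx]
      have := hDnn x
      positivity
    · constructor
      · rw [injective_iff_map_eq_zero]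
        intro x hx
        rw [ContinuousLinearMap.add_apply] at hx
        have h1 : ⟪D x, x⟫ + ‖PW x‖ ^ 2 = 0 := by
          rw [← hPWx, ← inner_add_left, hx, inner_zero_left]
        have h2 : PW x = 0 := by
          have : ‖PW x‖ ^ 2 = 0 := by nlinarith [hDnn x, sq_nonneg ‖PW x‖]
          simpa using this
        rw [h2, add_zero] at hx
        rw [← hPWw x (hDker x hx), h2]
      · intro y
        obtain ⟨v, hv, hvy⟩ := hinvV.surjOn (hPV y)
        refine ⟨v + PW y, ?_⟩
        have hvy' : D v = PV y := hvy
        rw [ContinuousLinearMap.add_apply, map_add, map_add, hDW _ (hPW y), hPWV v hv,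
          hPWw _ (hPW y), hvy', add_zero, zero_add, hPVW]
  -- Wronskian identities
  have hVA : ∀ x y, ⟪PV x, (-Abar + PW) y⟫ - ⟪(-A + PW) x, PV y⟫ = ⟪x, D y⟫ := by
    intro x y
    have e1 : ⟪PV x, PW y⟫ = 0 := horth _ (hPV x) _ (hPW y)
    have e2 : ⟪PW x, PV y⟫ = 0 := by rw [real_inner_comm]; exact horth _ (hPV y) _ (hPW x)
    have e3 : ⟪PV x, Abar y⟫ = ⟪x, Abar y⟫ := by
      rw [real_inner_comm, hVPW _ (hAbarRange y), real_inner_comm]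
    simp [inner_add_left, inner_add_right, e1, e2, e3, hVPW _ (hArange x), hAsymm x y, hD,
      inner_sub_right]
    ring
  have hVA0 : ∀ x y, ⟪PV x, (-A + PW) y⟫ - ⟪(-A + PW) x, PV y⟫ = 0 := by
    intro x y
    have e1 : ⟪PV x, PW y⟫ = 0 := horth _ (hPV x) _ (hPW y)
    have e2 : ⟪PW x, PV y⟫ = 0 := by rw [real_inner_comm]; exact horth _ (hPV y) _ (hPW x)
    have e3 : ⟪PV x, A y⟫ = ⟪x, A y⟫ := by
      rw [real_inner_comm, hVPW _ (hArange y), real_inner_comm]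
    simp [inner_add_left, inner_add_right, e1, e2, e3, hVPW _ (hArange x), hAsymm x y]
  have hWr : ∀ t ∈ Icc (0:ℝ) b, ∀ x y, ⟪T t x, Tbar' t y⟫ - ⟪T' t x, Tbar t y⟫ = ⟪x, D y⟫ :=
    fun t ht x y => (aux_wronskian b R hRsymm hT hTbar x y t ht).trans (hVA x y)
  have hWr0 : ∀ t ∈ Icc (0:ℝ) b, ∀ x y, ⟪T t x, T' t y⟫ - ⟪T' t x, T t y⟫ = 0 :=
    fun t ht x y => (aux_wronskian b R hRsymm hT hT x y t ht).trans (hVA0 x y)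
  obtain ⟨hT1, -, -, -, hT4, hT5⟩ := hT
  obtain ⟨hS1, -, -, -, hS4, hS5⟩ := hTbar
  have hunit : ∀ t ∈ Ioo (0:ℝ) b, IsUnit (T t) := fun t ht =>
    ContinuousLinearMap.isUnit_iff_bijective.2 (hTbij t ht)
  -- the operator `S = T⁻¹ Tbar`
  set S : ℝ → H →L[ℝ] H := fun t => Ring.inverse (T t) * Tbar t with hS
  have hlim : Filter.Tendsto S (nhdsWithin 0 (Ioi 0)) (nhds  1) := by
    have h0 : (0:ℝ) ∈ Icc 0 b := ⟨le_rfl, hb.le⟩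
    have hmem : Icc 0 b ∈ nhdsWithin (0:ℝ) (Ioi 0) := Icc_mem_nhdsGT hb
    apply aux_lim PV PW A D
    · ext x; exact hPVW x
    · ext x; exact hPVv _ (hPV x)
    · ext x; exact hPVw _ (hPW x)
    · ext x; exact hAW _ (hPW x)
    · ext x; exact hPWV _ (hDV x)
    · ext x; exact hPWw _ (hPW x)
    · exact hT4
    · exact hS4
    · rw [← hT5]; exact (hT1 0 h0).mono_of_mem_nhdsWithin hmem
    · have : -(A - D) + PW = Tbar' 0 := by rw [hS5, hD]; abel
      rw [this]; exact (hS1 0 h0).mono_of_mem_nhdsWithin hmem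
    · filter_upwards [Ioo_mem_nhdsGT hb] with t ht using hunit t ht
  have hTS : ∀ t ∈ Ioo (0:ℝ) b, ∀ x, T t (S t x) = Tbar t x := by
    intro t ht x
    have : T t * S t = Tbar t := by
      rw [hS, ← mul_assoc, Ring.mul_inverse_cancel _ (hunit t ht), one_mul]
    rw [← this]; rfl
  have hder : ∀ t ∈ Ioo (0:ℝ) b, ∃ S' : H →L[ℝ] H, HasDerivAt S S' t ∧
      ∀ x, T t (S' x) = Tbar' t x - T' t (S t x) := by
    intro t ht
    have hn : Icc 0 b ∈ nhds  t := Icc_mem_nhds ht.1 ht.2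
    have ht' : t ∈ Icc 0 b := ⟨ht.1.le, ht.2.le⟩
    have d1 := (hT1 t ht').hasDerivAt hn
    have d2 := (hS1 t ht').hasDerivAt hn
    obtain ⟨u, hu⟩ := hunit t ht
    have d3 : HasFDerivAt Ring.inverse _ (T t) := hu ▸ hasFDerivAt_ringInverse (𝕜 := ℝ) u
    have d4 := (d3.comp_hasDerivAt t d1).mul d2
    refine ⟨_, d4, fun x => ?_⟩
    have hui : Ring.inverse (T t) = ((u⁻¹ : (H →L[ℝ] H)ˣ) : H →L[ℝ] H) := by
      rw [← hu, Ring.inverse_unit]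
    have hk : ∀ z, T t ((u⁻¹ : (H →L[ℝ] H)ˣ).1 z) = z := fun z => by
      have := u.mul_inv
      rw [hu] at this
      exact congrArg (fun f : H →L[ℝ] H => f z) this
    simp [hS, hui, hk]
    abel
  choose! S' hS'd hS'T using hder
  have hS'D : ∀ t ∈ Ioo (0:ℝ) b, ∀ x y, ⟪T t y, T t (S' t x)⟫ = ⟪y, D x⟫ := by
    intro t ht x y
    have ht' : t ∈ Icc 0 b := ⟨ht.1.le, ht.2.le⟩
    have h1 := hWr t ht' y x
    have h2 := hWr0 t ht' y (S t x)
    rw [hTS t ht] at h2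
    rw [hS'T t ht, inner_sub_right]
    linarith
  have hmono : ∀ x y, (∀ t ∈ Ioo (0:ℝ) b, 0 ≤ ⟪y, S' t x⟫) →
      ∀ t ∈ Ioo (0:ℝ) b, ⟪y, x⟫ ≤ ⟪y, S t x⟫ := by
    intro x y h
    refine aux_mono (fun t => ⟪y, S t x⟫) (fun t => ⟪y, S' t x⟫) _ ?_ h ?_
    · intro t ht
      have a1 := (hS'd t ht).clm_apply (hasDerivAt_const t x)
      have := (hasDerivAt_const t y).inner ℝ a1
      simpa using this
    · have hc1 : Continuous (fun L : H →L[ℝ] H => ⟪y, L x⟫) := by fun_prop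
      exact (hc1.tendsto 1).comp hlim
  intro t ht
  have hSW : ∀ w ∈ W, S t w = w := by
    intro w hw
    have hz : ∀ t ∈ Ioo (0:ℝ) b, S' t w = 0 := by
      intro t ht
      have h1 := hS'D t ht w (S' t w)
      rw [hDW w hw, inner_zero_right, inner_self_eq_zero] at h1
      exact (hTbij t ht).1 (by rw [h1, map_zero])
    have h2 := hmono w (w - S t w) (fun s hs => by rw [hz s hs, inner_zero_right]) t ht
    have h3 : ⟪w - S t w, w - S t w⟫ ≤ 0 := by
      rw [inner_sub_right]; linarith
    have h4 : w - S t w = 0 := by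
      rw [← inner_self_eq_zero (𝕜 := ℝ)]
      exact le_antisymm h3 real_inner_self_nonneg
    exact (sub_eq_zero.1 h4).symm
  have hDS : ∀ x, ⟪D x, x⟫ ≤ ⟪D x, S t x⟫ := by
    intro x
    refine hmono x (D x) (fun s hs => ?_) t ht
    rw [real_inner_comm, ← hS'D s hs]
    exact real_inner_self_nonneg
  have hM : Function.Bijective (D * S t + PW) := by
    refine aux_bij _ c hc fun x => (hcoer x).trans ?_
    have h1 : ⟪D (S t x), x⟫ = ⟪D x, S t x⟫ := by rw [hDs, real_inner_comm]
    have h2 := hDS x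
    simp only [ContinuousLinearMap.add_apply, ContinuousLinearMap.mul_apply, inner_add_left, h1]
    linarith
  have hSbij : Function.Bijective (S t) := by
    constructor
    · rw [injective_iff_map_eq_zero]
      intro x hx
      have h1 := hcoer x
      have h2 := hDS x
      rw [hx, inner_zero_right] at h2
      have h3 : x ∈ W := by
        by_contra hne
        have h4 : PV x ≠ 0 := fun h => hne (by
          have := hPVW x
          rw [h, zero_add] at this
          exact this ▸ hPW x)
        have h5 := hpos _ (hPV x) h4
        rw [← hDx] at h5
        linarith
      rw [← hSW x h3, hx]
    · intro y
      obtain ⟨x, hx⟩ := hM.2 (D y)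
      have hx' : D (S t x) + PW x = D y := hx
      have h1 : PW x = 0 := by
        have := congrArg PW hx'
        rwa [map_add, hPWV _ (hDV _), hPWV _ (hDV _), hPWw _ (hPW x), zero_add] at this
      rw [h1, add_zero] at hx'
      have h2 : S t x - y ∈ W := hDker _ (by rw [map_sub, hx', sub_self])
      exact ⟨x - (S t x - y), by rw [map_sub, hSW _ h2]; abel⟩
  have : (Tbar t : H → H) = T t ∘ S t := by
    ext x; exact (hTS t ht x).symm
  rw [this]
  exact (hTbij t ht).comp hSbij
end

section
/- Let D : ℓ²(ℕ, ℝ) → ℓ²(ℕ, ℝ) be the bounded diagonal operator defined by (D x)(n) = sin(π / (2(n+3))) · x(n). Then D is injective and has dense range, but D is not surjective: the sequence y given by y(n) = 1/(n+3) belongs to ℓ²(ℕ, ℝ) but does not lie in the range of D. -/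
open Real

/-- The diagonal operator `D` on `ℓ²(ℕ, ℝ)` with entries `sin(π / (2(n+3)))`
is injective and has dense range, but is not surjective: the square-summable
sequence `n ↦ 1/(n+3)` is not in its range. (This expresses that `γ(π/2)` in
the paper's ellipsoid example is an epifocal but not monofocal point.) -/
theorem diagonal_operator_pathological
    (D : lp (fun _ : ℕ => ℝ) 2 →L[ℝ] lp (fun _ : ℕ => ℝ) 2)
    (hD : ∀ (x : lp (fun _ : ℕ => ℝ) 2) (n : ℕ),
      (D x : ∀ _ : ℕ, ℝ) n = Real.sin (π / (2 * ((n : ℝ) + 3))) * (x : ∀ _ : ℕ, ℝ) n) :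
    Function.Injective D ∧ Dense (Set.range D) ∧ ¬ Function.Surjective D ∧
      ∃ y : lp (fun _ : ℕ => ℝ) 2,
        (∀ n : ℕ, (y : ∀ _ : ℕ, ℝ) n = 1 / ((n : ℝ) + 3)) ∧
        y ∉ Set.range D := by
  have hpos : ∀ n : ℕ, 0 < Real.sin (π / (2 * ((n : ℝ) + 3))) := by
    intro n
    have hn : (0 : ℝ) ≤ n := Nat.cast_nonneg n
    apply Real.sin_pos_of_pos_of_lt_pi
    · have := Real.pi_pos
      positivity
    · apply div_lt_self Real.pi_pos
      linarith
  have hy : Memℓp (fun n : ℕ => (1 : ℝ) / ((n : ℝ) + 3)) 2 := by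
    apply memℓp_gen
    have h := (summable_nat_add_iff 3).mpr
      (Real.summable_one_div_nat_pow.mpr (by norm_num : 1 < 2))
    refine h.congr fun n => ?_
    have hn : (0 : ℝ) ≤ n := Nat.cast_nonneg n
    have h1 : (0 : ℝ) ≤ 1 / ((n : ℝ) + 3) := by positivity
    simp only [Real.norm_of_nonneg h1, ENNReal.toReal_ofNat, Real.rpow_two]
    push_cast
    rw [div_pow, one_pow]
  have key : (⟨fun n : ℕ => (1 : ℝ) / ((n : ℝ) + 3), hy⟩ : lp (fun _ : ℕ => ℝ) 2)
      ∉ Set.range D := by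
    rintro ⟨x, hx⟩
    have hlow : ∀ n : ℕ, 2 / π ≤ x n := by
      intro n
      have hn : (0 : ℝ) ≤ n := Nat.cast_nonneg n
      have h1 : Real.sin (π / (2 * ((n : ℝ) + 3))) * x n = 1 / ((n : ℝ) + 3) := by
        rw [← hD, hx]
      have hx0 : 0 < x n := by
        have : 0 < Real.sin (π / (2 * ((n : ℝ) + 3))) * x n := by
          rw [h1]; positivity
        exact (pos_iff_pos_of_mul_pos this).mp (hpos n)
      have h2 : Real.sin (π / (2 * ((n : ℝ) + 3))) ≤ π / (2 * ((n : ℝ) + 3)) :=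
        Real.sin_le (by have := Real.pi_pos; positivity)
      have h3 := mul_le_mul_of_nonneg_right h2 hx0.le
      rw [h1] at h3
      have hpi := Real.pi_pos
      rw [div_mul_eq_mul_div, div_le_div_iff₀ (by positivity) (by positivity)] at h3
      rw [div_le_iff₀ hpi]
      have h4 : 0 < (n : ℝ) + 3 := by positivity
      nlinarith
    have hs := (lp.memℓp x).summable (by norm_num)
    have ht := hs.tendsto_atTop_zero
    have hc : (2 / π) ^ 2 ≤ (0 : ℝ) := by
      refine ge_of_tendsto' ht fun n => ?_
      have hpi := Real.pi_pos
      have h0 : (0 : ℝ) ≤ 2 / π := by positivity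
      simp only [ENNReal.toReal_ofNat, Real.rpow_two]
      exact pow_le_pow_left₀ h0 ((hlow n).trans (le_abs_self _)) 2
    have hpi := Real.pi_pos
    have : (0 : ℝ) < (2 / π) ^ 2 := by positivity
    linarith
  refine ⟨?_, ?_, fun h => key (h _), _, fun n => rfl, key⟩
  · intro x z h
    ext n
    have h1 := congrArg (fun w : lp (fun _ : ℕ => ℝ) 2 => w n) h
    simp only [hD] at h1
    exact mul_left_cancel₀ (hpos n).ne' h1
  · intro x
    have hs := lp.hasSum_single (E := fun _ : ℕ => ℝ) (p := 2) (by norm_num) x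
    refine mem_closure_of_tendsto hs (Filter.Eventually.of_forall fun s => ?_)
    change _ ∈ LinearMap.range (D : lp (fun _ : ℕ => ℝ) 2 →ₗ[ℝ] lp (fun _ : ℕ => ℝ) 2)
    refine Submodule.sum_mem _ fun i _ => ?_
    refine ⟨lp.single 2 i (x i / Real.sin (π / (2 * ((i : ℝ) + 3)))), ?_⟩
    ext n
    change (D _ : ∀ _ : ℕ, ℝ) n = _
    rw [hD]
    by_cases hni : n = i
    · subst hni
      simp only [lp.single_apply_self]
      exact mul_div_cancel₀ _ (hpos n).ne'
    · simp [lp.single_apply, hni]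
end
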